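/- arXiv:2012.15191 — 12 statements merged into one kernel-verified Lean document; each statement's English description precedes it below -/
import Mathlib

section
/- Let V : ℝ → ℝ be continuous with ∫_ℝ (1+|y|)|V(y)| dy < ∞, fix ξ ∈ ℝ, and let m : ℝ → ℂ be a bounded continuous solution of the Volterra equation m(x) = 1 + ∫_x^∞ D_ξ(y−x) V(y) m(y) dy, where D_ξ(t) = ∫_0^t e^{2iξu} du. Then the function f(x) := e^{ixξ} m(x) is twice continuously differentiable on ℝ, satisfies the Schrödinger equation −f''(x) + V(x) f(x) = ξ² f(x) for all x ∈ ℝ, and e^{−ixξ} f(x) → 1 as x → +∞. -/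
open MeasureTheory Filter Topology

/-- The tail `x ↦ ∫_x^∞ F` of an integrable continuous function has derivative `-F`. -/
theorem hasDerivAt_setIntegral_Ioi {E : Type*} [NormedAddCommGroup E] [NormedSpace ℝ E]
    [CompleteSpace E] {F : ℝ → E} (hF : Continuous F) (hFi : Integrable F) (x : ℝ) :
    HasDerivAt (fun z : ℝ => ∫ y in Set.Ioi z, F y) (-F x) x := by
  have h : (fun z : ℝ => ∫ y in Set.Ioi z, F y)
      = fun z => (∫ y in Set.Ioi (0 : ℝ), F y) - ∫ y in (0 : ℝ)..z, F y := by
    funext z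
    rw [← intervalIntegral.integral_interval_add_Ioi (a := 0) (b := z) hFi.integrableOn
      hFi.integrableOn]
    abel
  rw [h]
  exact (hF.integral_hasStrictDerivAt 0 x).hasDerivAt.const_sub _

/-- The Volterra kernel `D_ξ(t) = ∫_0^t e^{2iξu} du`. -/
noncomputable def volterraKernel (ξ t : ℝ) : ℂ :=
  ∫ u in (0 : ℝ)..t, Complex.exp (2 * Complex.I * ξ * u)

theorem continuous_cexp_two_mul (ξ : ℝ) :
    Continuous fun u : ℝ => Complex.exp (2 * Complex.I * ξ * u) := by
  fun_prop

theorem hasDerivAt_volterraKernel (ξ t : ℝ) :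
    HasDerivAt (volterraKernel ξ) (Complex.exp (2 * Complex.I * ξ * t)) t :=
  ((continuous_cexp_two_mul ξ).integral_hasStrictDerivAt 0 t).hasDerivAt

theorem continuous_volterraKernel (ξ : ℝ) : Continuous (volterraKernel ξ) :=
  continuous_iff_continuousAt.2 fun t => (hasDerivAt_volterraKernel ξ t).continuousAt

theorem norm_volterraKernel_le (ξ t : ℝ) : ‖volterraKernel ξ t‖ ≤ |t| := by
  have h := intervalIntegral.norm_integral_le_of_norm_le_const (a := 0) (b := t) (C := 1)
    (f := fun u : ℝ => Complex.exp (2 * Complex.I * ξ * u)) fun u _ => by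
      simp [Complex.norm_exp]
  simpa [volterraKernel] using h

theorem hasDerivAt_cexp_mul_ofReal (c : ℂ) (x : ℝ) :
    HasDerivAt (fun t : ℝ => Complex.exp (c * t)) (c * Complex.exp (c * x)) x := by
  have h := ((hasDerivAt_id (x : ℂ)).const_mul c).cexp.comp_ofReal
  simpa [mul_comm] using h

theorem one_add_volterraKernel (ξ t : ℝ) :
    1 + 2 * Complex.I * ξ * volterraKernel ξ t = Complex.exp (2 * Complex.I * ξ * t) := by
  have h := intervalIntegral.integral_eq_sub_of_hasDerivAt (a := 0) (b := t)
    (fun u _ => hasDerivAt_cexp_mul_ofReal (2 * Complex.I * ξ) u)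
    (((continuous_cexp_two_mul ξ).const_mul _).intervalIntegrable 0 t)
  rw [intervalIntegral.integral_const_mul] at h
  rw [volterraKernel, h]
  simp

theorem volterraKernel_add (ξ s t : ℝ) :
    volterraKernel ξ (s + t)
      = volterraKernel ξ s + Complex.exp (2 * Complex.I * ξ * s) * volterraKernel ξ t := by
  have hi := fun a b => (continuous_cexp_two_mul ξ).intervalIntegrable (μ := volume) a b
  rw [volterraKernel, ← intervalIntegral.integral_add_adjacent_intervals (hi 0 s) (hi s (s + t)),
    volterraKernel, volterraKernel, ← intervalIntegral.integral_const_mul]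
  congr 1
  have h := intervalIntegral.integral_comp_add_left (a := 0) (b := t)
    (fun u : ℝ => Complex.exp (2 * Complex.I * ξ * u)) s
  rw [add_zero] at h
  rw [← h]
  refine intervalIntegral.integral_congr fun u _ => ?_
  simp only [← Complex.exp_add]
  push_cast
  ring_nf

section VolterraIntegral

variable {W : ℝ → ℂ}

theorem integrable_volterraKernel_mul (hW : Continuous W)
    (hWi : Integrable fun y : ℝ => (1 + |y|) * ‖W y‖) (ξ : ℝ) :
    Integrable fun y => volterraKernel ξ y * W y := by
  refine hWi.mono' ((continuous_volterraKernel ξ).mul hW).aestronglyMeasurable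
    (ae_of_all _ fun y => ?_)
  rw [norm_mul]
  gcongr
  linarith [norm_volterraKernel_le ξ y]

theorem integrable_of_integrable_one_add_abs_mul (hW : Continuous W)
    (hWi : Integrable fun y : ℝ => (1 + |y|) * ‖W y‖) : Integrable W := by
  refine hWi.mono' hW.aestronglyMeasurable (ae_of_all _ fun y => ?_)
  exact le_mul_of_one_le_left (norm_nonneg _) (by linarith [abs_nonneg y])

theorem setIntegral_volterraKernel_sub (hW : Continuous W)
    (hWi : Integrable fun y : ℝ => (1 + |y|) * ‖W y‖) (ξ x : ℝ) :
    ∫ y in Set.Ioi x, volterraKernel ξ (y - x) * W y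
      = volterraKernel ξ (-x) * (∫ y in Set.Ioi x, W y)
        + Complex.exp (-(2 * Complex.I * ξ) * x)
          * ∫ y in Set.Ioi x, volterraKernel ξ y * W y := by
  have h : ∀ y : ℝ, volterraKernel ξ (y - x) * W y = volterraKernel ξ (-x) * W y
      + Complex.exp (-(2 * Complex.I * ξ) * x) * (volterraKernel ξ y * W y) := fun y => by
    rw [sub_eq_neg_add, volterraKernel_add]
    push_cast
    ring_nf
  simp_rw [h]
  rw [integral_add, integral_const_mul, integral_const_mul]
  · exact ((integrable_of_integrable_one_add_abs_mul hW hWi).const_mul _).integrableOn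
  · exact ((integrable_volterraKernel_mul hW hWi ξ).const_mul _).integrableOn

/-- Differentiation of the Volterra integral: only the derivative of the kernel contributes,
since `D_ξ(0) = 0`. -/
theorem hasDerivAt_setIntegral_volterraKernel (hW : Continuous W)
    (hWi : Integrable fun y : ℝ => (1 + |y|) * ‖W y‖) (ξ x : ℝ) :
    HasDerivAt (fun z : ℝ => ∫ y in Set.Ioi z, volterraKernel ξ (y - z) * W y)
      (-(Complex.exp (-(2 * Complex.I * ξ) * x)
        * ∫ y in Set.Ioi x, Complex.exp (2 * Complex.I * ξ * y) * W y)) x := by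
  have hWi' := integrable_of_integrable_one_add_abs_mul hW hWi
  have hDi := integrable_volterraKernel_mul hW hWi ξ
  have hA := hasDerivAt_setIntegral_Ioi hW hWi' x
  have hB := hasDerivAt_setIntegral_Ioi ((continuous_volterraKernel ξ).mul hW) hDi x
  have hD := (hasDerivAt_volterraKernel ξ (-x)).scomp x (hasDerivAt_neg x)
  have hE := hasDerivAt_cexp_mul_ofReal (-(2 * Complex.I * ξ)) x
  have hsplit : ∫ y in Set.Ioi x, Complex.exp (2 * Complex.I * ξ * y) * W y
      = (∫ y in Set.Ioi x, W y)
        + 2 * Complex.I * ξ * ∫ y in Set.Ioi x, volterraKernel ξ y * W y := by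
    simp_rw [← one_add_volterraKernel, add_mul, one_mul, mul_assoc _ (volterraKernel ξ _)]
    rw [integral_add hWi'.integrableOn (hDi.const_mul _).integrableOn, integral_const_mul]
  have hzero : volterraKernel ξ (-x)
      + Complex.exp (-(2 * Complex.I * ξ) * x) * volterraKernel ξ x = 0 := by
    have h := volterraKernel_add ξ (-x) x
    rw [neg_add_cancel, volterraKernel, intervalIntegral.integral_same] at h
    rw [h]
    push_cast
    ring_nf
  rw [funext (setIntegral_volterraKernel_sub hW hWi ξ), hsplit]
  refine ((hD.mul hA).add (hE.mul hB)).congr_deriv ?_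
  have hexp : Complex.exp (2 * Complex.I * ξ * ((-x : ℝ) : ℂ))
      = Complex.exp (-(2 * Complex.I * ξ) * x) := by
    push_cast
    ring_nf
  simp only [Function.comp_apply, Pi.mul_apply, neg_smul, one_smul, hexp]
  linear_combination -W x * hzero

/-- The Volterra integral vanishes at `+∞`. -/
theorem tendsto_setIntegral_volterraKernel
    (hWi : Integrable fun y : ℝ => (1 + |y|) * ‖W y‖) (ξ : ℝ) :
    Tendsto (fun x : ℝ => ∫ y in Set.Ioi x, volterraKernel ξ (y - x) * W y) atTop (𝓝 0) := by
  refine squeeze_zero_norm' ?_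
    (tendsto_integral_Ioi_zero (f := fun y : ℝ => (1 + |y|) * ‖W y‖) (μ := volume) tendsto_id)
  filter_upwards [eventually_ge_atTop 0] with x hx
  refine norm_integral_le_of_norm_le hWi.integrableOn
    ((ae_restrict_iff' measurableSet_Ioi).2 (ae_of_all _ fun y hy => ?_))
  have hy' : x < y := hy
  rw [norm_mul]
  gcongr
  have h := norm_volterraKernel_le ξ (y - x)
  rw [abs_of_pos (sub_pos.2 hy')] at h
  linarith [le_abs_self y]

end VolterraIntegral

theorem integrable_one_add_abs_mul_norm_mul {V : ℝ → ℝ} {m : ℝ → ℂ} (hV : Continuous V)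
    (hVint : Integrable fun y : ℝ => (1 + |y|) * |V y|) (hm : Continuous m)
    (hmb : Bornology.IsBounded (Set.range m)) :
    Integrable fun y : ℝ => (1 + |y|) * ‖(V y : ℂ) * m y‖ := by
  obtain ⟨K, hK⟩ := hmb.exists_norm_le
  refine (hVint.mul_const K).mono' (by fun_prop) (ae_of_all _ fun y => ?_)
  have hp : 0 ≤ 1 + |y| := by positivity
  rw [norm_mul, norm_norm, norm_mul, Complex.norm_real, Real.norm_eq_abs, Real.norm_eq_abs,
    abs_of_nonneg hp, ← mul_assoc]
  gcongr
  exact hK _ ⟨y, rfl⟩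

/-- A function with a continuous second derivative is `C²`. -/
theorem contDiff_two_of_hasDerivAt {f g h : ℝ → ℂ} (hf : ∀ x, HasDerivAt f (g x) x)
    (hg : ∀ x, HasDerivAt g (h x) x) (hh : Continuous h) : ContDiff ℝ 2 f := by
  have hg1 : ContDiff ℝ 1 g := contDiff_one_iff_deriv.2
    ⟨fun x => (hg x).differentiableAt, by rwa [funext fun x => (hg x).deriv]⟩
  rw [← one_add_one_eq_two, contDiff_succ_iff_deriv]
  exact ⟨fun x => (hf x).differentiableAt, by simp, by rwa [funext fun x => (hf x).deriv]⟩

/-- If `m` is a bounded continuous solution of the Volterra equation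
`m(x) = 1 + ∫_x^∞ D_ξ(y − x) V(y) m(y) dy` with `D_ξ(t) = ∫_0^t e^{2iξu} du`,
then `f(x) = e^{ixξ} m(x)` is `C²`, solves the Schrödinger equation
`−f'' + V f = ξ² f`, and satisfies `e^{−ixξ} f(x) → 1` as `x → +∞`
(construction of the Jost solution `f₊(·, ξ)`). -/
theorem jost_solution_of_volterra
    (V : ℝ → ℝ) (hV : Continuous V)
    (hVint : Integrable (fun y : ℝ => (1 + |y|) * |V y|))
    (ξ : ℝ) (m : ℝ → ℂ)
    (hm : Continuous m) (hmb : Bornology.IsBounded (Set.range m))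
    (heq : ∀ x : ℝ, m x = 1 + ∫ y in Set.Ioi x,
      (∫ u in (0:ℝ)..(y - x), Complex.exp (2 * Complex.I * ξ * u)) * (V y : ℂ) * m y) :
    ContDiff ℝ 2 (fun x : ℝ => Complex.exp (Complex.I * x * ξ) * m x) ∧
    (∀ x : ℝ,
      -(deriv (deriv (fun x : ℝ => Complex.exp (Complex.I * x * ξ) * m x)) x)
        + (V x : ℂ) * (Complex.exp (Complex.I * x * ξ) * m x)
        = (ξ : ℂ) ^ 2 * (Complex.exp (Complex.I * x * ξ) * m x)) ∧
    Tendsto (fun x : ℝ =>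
        Complex.exp (-(Complex.I) * x * ξ) * (Complex.exp (Complex.I * x * ξ) * m x))
      atTop (𝓝 1) := by
  set W : ℝ → ℂ := fun y => (V y : ℂ) * m y with hWdef
  have hW : Continuous W := by fun_prop
  have hWi : Integrable fun y : ℝ => (1 + |y|) * ‖W y‖ :=
    integrable_one_add_abs_mul_norm_mul hV hVint hm hmb
  have hm_eq : m = fun x => 1 + ∫ y in Set.Ioi x, volterraKernel ξ (y - x) * W y := by
    funext x
    rw [heq x]
    simp only [hWdef, volterraKernel, mul_assoc]
  set C : ℝ → ℂ := fun x => ∫ y in Set.Ioi x, Complex.exp (2 * Complex.I * ξ * y) * W y with hC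
  set m' : ℝ → ℂ := fun x => -(Complex.exp (-(2 * Complex.I * ξ) * x) * C x) with hm'
  have hdm : ∀ x, HasDerivAt m (m' x) x := fun x => by
    rw [hm_eq]
    exact (hasDerivAt_setIntegral_volterraKernel hW hWi ξ x).const_add 1
  have hEWi : Integrable fun y : ℝ => Complex.exp (2 * Complex.I * ξ * y) * W y :=
    (integrable_of_integrable_one_add_abs_mul hW hWi).mono
      ((continuous_cexp_two_mul ξ).mul hW).aestronglyMeasurable
      (ae_of_all _ fun y => by simp [Complex.norm_exp])
  have hdm' : ∀ x, HasDerivAt m' (-(2 * Complex.I * ξ) * m' x + W x) x := fun x => by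
    have hexp : Complex.exp (-(2 * Complex.I * ξ) * x) * Complex.exp (2 * Complex.I * ξ * x)
        = 1 := by
      rw [← Complex.exp_add]
      simp
    refine ((hasDerivAt_cexp_mul_ofReal (-(2 * Complex.I * ξ)) x).mul
      (hasDerivAt_setIntegral_Ioi ((continuous_cexp_two_mul ξ).mul hW) hEWi x)).neg.congr_deriv ?_
    simp only [hm', hC, Pi.mul_apply]
    linear_combination W x * hexp
  have hde : ∀ x : ℝ, HasDerivAt (fun t : ℝ => Complex.exp (Complex.I * t * ξ))
      (Complex.I * ξ * Complex.exp (Complex.I * x * ξ)) x := fun x => by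
    simpa only [mul_right_comm] using hasDerivAt_cexp_mul_ofReal (Complex.I * ξ) x
  have hdf : ∀ x : ℝ, HasDerivAt (fun t : ℝ => Complex.exp (Complex.I * t * ξ) * m t)
      (Complex.exp (Complex.I * x * ξ) * (Complex.I * ξ * m x + m' x)) x := fun x =>
    ((hde x).mul (hdm x)).congr_deriv (by ring)
  have hddf : ∀ x : ℝ, HasDerivAt
      (fun t : ℝ => Complex.exp (Complex.I * t * ξ) * (Complex.I * ξ * m t + m' t))
      (((V x : ℂ) - (ξ : ℂ) ^ 2) * (Complex.exp (Complex.I * x * ξ) * m x)) x := fun x =>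
    ((hde x).mul (((hdm x).const_mul (Complex.I * ξ)).add (hdm' x))).congr_deriv (by
      simp only [hWdef, Pi.add_apply]
      linear_combination Complex.exp (Complex.I * x * ξ) * ξ ^ 2 * m x * Complex.I_sq)
  refine ⟨contDiff_two_of_hasDerivAt hdf hddf (by fun_prop), fun x => ?_, ?_⟩
  · rw [funext fun t => (hdf t).deriv, (hddf x).deriv]
    ring
  · have h : ∀ x : ℝ, Complex.exp (-(Complex.I) * x * ξ)
        * (Complex.exp (Complex.I * x * ξ) * m x) = m x := fun x => by
      rw [← mul_assoc, ← Complex.exp_add]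
      simp
    simp_rw [h]
    rw [hm_eq]
    simpa using (tendsto_setIntegral_volterraKernel hWi ξ).const_add 1
end

section
/- Let V : ℝ → ℝ be continuous with ∫_ℝ (1+|y|)|V(y)| dy < ∞ and fix ξ ∈ ℝ. Suppose f₁, f₂ : ℝ → ℂ are twice continuously differentiable, both satisfy −f''(x) + V(x) f(x) = ξ² f(x) for all x ∈ ℝ, and for j = 1, 2 one has e^{−ixξ} f_j(x) → 1 and (d/dx)(e^{−ixξ} f_j(x)) → 0 as x → +∞. Then f₁ = f₂ (uniqueness of the Jost solution f₊(·,ξ)). -/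
open MeasureTheory Filter Topology

/-- A function vanishing at `+∞` is dominated by any nonnegative primitive dominating its
derivative on a right half-line. -/
lemma norm_le_of_norm_deriv_le_of_tendsto_zero {E : Type*} [NormedAddCommGroup E]
    [NormedSpace ℝ E] {F F' : ℝ → E} {G g : ℝ → ℝ} {a : ℝ}
    (hF : ∀ x, HasDerivAt F (F' x) x) (hG : ∀ x, HasDerivAt G (-g x) x)
    (hG0 : ∀ x, a ≤ x → 0 ≤ G x) (hFG : ∀ x, a ≤ x → ‖F' x‖ ≤ g x)
    (hlim : Tendsto F atTop (𝓝 0)) {x : ℝ} (hx : a ≤ x) : ‖F x‖ ≤ G x := by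
  have hlim' : Tendsto (fun T => ‖F T‖ + G x) atTop (𝓝 (G x)) := by
    simpa using hlim.norm.add_const (G x)
  refine ge_of_tendsto hlim' ?_
  filter_upwards [eventually_ge_atTop x] with T hT
  have key := image_norm_le_of_norm_deriv_right_le_deriv_boundary
    (f := fun y => F y - F x) (f' := F') (a := x) (b := T)
    (B := fun y => G x - G y) (B' := g)
    (fun y _ => ((hF y).sub_const _).continuousAt.continuousWithinAt)
    (fun y _ => ((hF y).sub_const _).hasDerivWithinAt) (by simp)
    (fun y => by simpa using (hG y).const_sub (G x))
    (fun y hy => hFG y (hx.trans hy.1)) (Set.right_mem_Icc.2 hT)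
  have := norm_sub_norm_le (F x) (F T)
  rw [norm_sub_rev] at this
  linarith [hG0 T (hx.trans hT)]

lemma hasDerivAt_setIntegral_Ioi_s2 {f : ℝ → ℝ} (hf : Continuous f) (hint : Integrable f) (x : ℝ) :
    HasDerivAt (fun t => ∫ y in Set.Ioi t, f y) (-f x) x := by
  have h : (fun t => ∫ y in Set.Ioi t, f y) =
      fun t => (∫ y in Set.Ioi 0, f y) - ∫ y in (0 : ℝ)..t, f y := by
    ext t
    rw [← intervalIntegral.integral_interval_add_Ioi (a := 0) (b := t)
      hint.integrableOn hint.integrableOn]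
    ring
  rw [h]
  exact (intervalIntegral.integral_hasDerivAt_right (hf.intervalIntegrable _ _)
    (hf.stronglyMeasurableAtFilter _ _) hf.continuousAt).const_sub _

/-- A solution of `g'' = (V − ξ²) g` with finite first moment of `V` vanishes near `+∞` as soon as
it tends to zero there together with `g' − iξ g`. -/
lemma exists_eq_zero_of_tendsto_zero {V : ℝ → ℝ} (hV : Continuous V)
    (hVint : Integrable (fun y : ℝ => (1 + |y|) * |V y|)) {ξ : ℝ} {g h : ℝ → ℂ}
    (hg : ∀ x, HasDerivAt g (h x) x)
    (hh : ∀ x, HasDerivAt h (((V x : ℂ) - (ξ : ℂ) ^ 2) * g x) x)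
    (hlim : Tendsto g atTop (𝓝 0))
    (hlim' : Tendsto (fun x => h x - Complex.I * ξ * g x) atTop (𝓝 0)) :
    ∃ a, ∀ x, a ≤ x → g x = 0 := by
  have hint0 : Integrable (fun y => |V y|) := by
    refine hVint.mono' hV.abs.aestronglyMeasurable (Eventually.of_forall fun y => ?_)
    rw [Real.norm_eq_abs, abs_abs]
    nlinarith [abs_nonneg y, abs_nonneg (V y), mul_nonneg (abs_nonneg y) (abs_nonneg (V y))]
  have hint1 : Integrable (fun y => y * |V y|) := by
    refine hVint.mono' (continuous_id.mul hV.abs).aestronglyMeasurable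
      (Eventually.of_forall fun y => ?_)
    rw [Real.norm_eq_abs, abs_mul, abs_abs]
    nlinarith [abs_nonneg (V y)]
  set A : ℝ → ℝ := fun t => ∫ y in Set.Ioi t, y * |V y| with hA
  set B : ℝ → ℝ := fun t => ∫ y in Set.Ioi t, |V y| with hB
  have hA' : ∀ x, HasDerivAt A (-(x * |V x|)) x :=
    hasDerivAt_setIntegral_Ioi_s2 (continuous_id.mul hV.abs) hint1
  have hB' : ∀ x, HasDerivAt B (-|V x|) x := hasDerivAt_setIntegral_Ioi_s2 hV.abs hint0
  have hB0 : ∀ x, 0 ≤ B x := fun x =>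
    setIntegral_nonneg measurableSet_Ioi fun y _ => abs_nonneg _
  have hΦ0 : ∀ x, 0 ≤ A x - x * B x := fun x => by
    rw [sub_nonneg, hA, hB, ← integral_const_mul]
    exact setIntegral_mono_on (hint0.const_mul x).integrableOn hint1.integrableOn measurableSet_Ioi
      fun y hy => mul_le_mul_of_nonneg_right (le_of_lt hy) (abs_nonneg _)
  have hΦ' : ∀ x, HasDerivAt (fun x => A x - x * B x) (-B x) x := fun x => by
    refine ((hA' x).sub ((hasDerivAt_id x).mul (hB' x))).congr_deriv ?_
    simp only [id]
    ring
  have hAlim : Tendsto A atTop (𝓝 0) := tendsto_integral_Ioi_zero tendsto_id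
  have hE : ∀ (c : ℂ) (x : ℝ), HasDerivAt (fun x : ℝ => Complex.exp (c * x))
      (Complex.exp (c * x) * c) x := fun c x => by
    simpa using ((Complex.ofRealCLM.hasDerivAt (x := x)).const_mul c).cexp
  have hnorm : ∀ s x : ℝ, ‖Complex.exp (Complex.I * s * x)‖ = 1 := fun s x => by
    rw [mul_assoc, ← Complex.ofReal_mul, Complex.norm_exp_I_mul_ofReal]
  set n : ℝ → ℂ := fun x => Complex.exp (Complex.I * ξ * x) * (h x - Complex.I * ξ * g x) with hn
  set m : ℝ → ℂ := fun x => Complex.exp (Complex.I * (-ξ : ℝ) * x) * g x with hm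
  have hnn : ∀ x, ‖n x‖ = ‖h x - Complex.I * ξ * g x‖ := fun x => by
    rw [hn]; simp only [norm_mul (Complex.exp _), hnorm, one_mul]
  have hmn : ∀ x, ‖m x‖ = ‖g x‖ := fun x => by
    rw [hm]; simp only [norm_mul (Complex.exp _), hnorm, one_mul]
  have hn' : ∀ x : ℝ, HasDerivAt n (Complex.exp (Complex.I * ξ * x) * (V x * g x)) x := fun x => by
    refine ((hE (Complex.I * ξ) x).mul ((hh x).sub ((hg x).const_mul (Complex.I * ξ)))).congr_deriv ?_
    simp only [Pi.sub_apply]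
    linear_combination -Complex.exp (Complex.I * ξ * x) * ξ ^ 2 * g x * Complex.I_sq
  have hm' : ∀ x : ℝ, HasDerivAt m
      (Complex.exp (Complex.I * (-ξ : ℝ) * x) * (h x - Complex.I * ξ * g x)) x := fun x => by
    refine ((hE (Complex.I * (-ξ : ℝ)) x).mul (hg x)).congr_deriv ?_
    push_cast
    ring
  have hnlim : Tendsto n atTop (𝓝 0) := by
    rw [tendsto_zero_iff_norm_tendsto_zero] at hlim' ⊢
    simpa only [hnn] using hlim'
  have hmlim : Tendsto m atTop (𝓝 0) := by
    rw [tendsto_zero_iff_norm_tendsto_zero] at hlim ⊢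
    simpa only [hmn] using hlim
  obtain ⟨a, ha⟩ := eventually_atTop.1 ((eventually_ge_atTop (0 : ℝ)).and
    ((hAlim.eventually_le_const (by norm_num : (0 : ℝ) < 1 / 2)).and
      (hlim.norm.eventually_le_const (by simp : ‖(0 : ℂ)‖ < 1))))
  have step : ∀ S : ℝ, 0 ≤ S → (∀ x, a ≤ x → ‖g x‖ ≤ S) → ∀ x, a ≤ x → ‖g x‖ ≤ S * (1 / 2) := by
    intro S hS hgS x hx
    have hnS : ∀ y, a ≤ y → ‖n y‖ ≤ S * B y := fun y hy =>
      norm_le_of_norm_deriv_le_of_tendsto_zero (g := fun y => S * |V y|) hn'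
        (fun y => by simpa using (hB' y).const_mul S) (fun y _ => mul_nonneg hS (hB0 y))
        (fun y hy => by
          rw [norm_mul, hnorm, one_mul, norm_mul, Complex.norm_real, Real.norm_eq_abs, mul_comm]
          exact mul_le_mul_of_nonneg_right (hgS y hy) (abs_nonneg _)) hnlim hy
    have hmS : ‖m x‖ ≤ S * (A x - x * B x) :=
      norm_le_of_norm_deriv_le_of_tendsto_zero (G := fun x => S * (A x - x * B x))
        (g := fun y => S * B y) hm'
        (fun y => by simpa using (hΦ' y).const_mul S) (fun y _ => mul_nonneg hS (hΦ0 y))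
        (fun y hy => by
          rw [norm_mul, hnorm, one_mul, ← hnn]
          exact hnS y hy) hmlim hx
    rw [hmn] at hmS
    refine hmS.trans (mul_le_mul_of_nonneg_left ?_ hS)
    linarith [(ha x hx).2.1, mul_nonneg (ha x hx).1 (hB0 x)]
  have hpow : ∀ k : ℕ, ∀ x, a ≤ x → ‖g x‖ ≤ (1 / 2 : ℝ) ^ k := by
    intro k
    induction k with
    | zero => simpa using fun x hx => (ha x hx).2.2
    | succ k ih => simpa only [pow_succ] using step _ (by positivity) ih
  refine ⟨a, fun x hx => norm_le_zero_iff.1 ?_⟩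
  exact ge_of_tendsto' (tendsto_pow_atTop_nhds_zero_of_lt_one (by norm_num) (by norm_num))
    fun k => hpow k x hx

/-- A solution of the linear equation `g'' = q g` vanishing on a right half-line is zero. -/
lemma eq_zero_of_eq_zero_on_Ici {q g h : ℝ → ℂ} (hq : Continuous q)
    (hg : ∀ x, HasDerivAt g (h x) x) (hh : ∀ x, HasDerivAt h (q x * g x) x)
    {a : ℝ} (ha : ∀ x, a ≤ x → g x = 0) : g = 0 := by
  have hh0 : h (a + 1) = 0 := by
    refine (hg (a + 1)).unique ((hasDerivAt_const (a + 1) (0 : ℂ)).congr_of_eventuallyEq ?_)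
    filter_upwards [lt_mem_nhds (lt_add_one a)] with y hy using ha y hy.le
  ext x
  obtain ⟨M, hM⟩ := (isCompact_Icc (a := min x a - 1)
    (b := max x a + 2)).exists_bound_of_continuousOn hq.continuousOn
  have key := ODE_solution_unique_of_mem_Ioo (v := fun t (p : ℂ × ℂ) => (p.2, q t * p.1))
    (s := fun _ => Set.univ) (K := 1 + M.toNNReal) (a := min x a - 1) (b := max x a + 2)
    (t₀ := a + 1) (f := fun t => (g t, h t)) (g := fun _ => (0, 0))
    (fun t ht => LipschitzOnWith.of_dist_le_mul fun p _ r _ => by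
      have hqM := (hM t (Set.Ioo_subset_Icc_self ht)).trans (Real.le_coe_toNNReal M)
      have h0 : (0 : ℝ) ≤ M.toNNReal := NNReal.coe_nonneg _
      have h1 := norm_fst_le (p - r)
      have h2 := norm_snd_le (p - r)
      have h3 := norm_nonneg (p - r)
      rw [dist_eq_norm, dist_eq_norm, Prod.norm_def]
      simp only [Prod.fst_sub, Prod.snd_sub, ← mul_sub, norm_mul, NNReal.coe_add,
        NNReal.coe_one] at h1 h2 ⊢
      refine max_le (by nlinarith) ?_
      have := mul_le_mul hqM h1 (norm_nonneg _) h0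
      linarith)
    ⟨by linarith [min_le_right x a], by linarith [le_max_right x a]⟩
    (fun t _ => ⟨(hg t).prodMk (hh t), Set.mem_univ _⟩)
    (fun t _ => ⟨by simpa using! hasDerivAt_const t ((0 : ℂ), (0 : ℂ)), Set.mem_univ _⟩)
    (by simp [hh0, ha (a + 1) (by linarith)])
  exact congrArg Prod.fst (key (x := x)
    ⟨by linarith [min_le_left x a], by linarith [le_max_left x a]⟩)

/-- Uniqueness of the Jost solution `f₊(·, ξ)`: two `C²` solutions of
`−f'' + V f = ξ² f` with `e^{−ixξ} f(x) → 1` and `(e^{−ixξ} f(x))' → 0`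
as `x → +∞` coincide. -/
theorem jost_solution_unique
    (V : ℝ → ℝ) (hV : Continuous V)
    (hVint : Integrable (fun y : ℝ => (1 + |y|) * |V y|))
    (ξ : ℝ) (f₁ f₂ : ℝ → ℂ)
    (hf₁ : ContDiff ℝ 2 f₁) (hf₂ : ContDiff ℝ 2 f₂)
    (heq₁ : ∀ x : ℝ, -(deriv (deriv f₁) x) + (V x : ℂ) * f₁ x = (ξ : ℂ) ^ 2 * f₁ x)
    (heq₂ : ∀ x : ℝ, -(deriv (deriv f₂) x) + (V x : ℂ) * f₂ x = (ξ : ℂ) ^ 2 * f₂ x)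
    (hlim₁ : Tendsto (fun x : ℝ => Complex.exp (-(Complex.I) * x * ξ) * f₁ x) atTop (𝓝 1))
    (hlim₁' : Tendsto (deriv (fun x : ℝ => Complex.exp (-(Complex.I) * x * ξ) * f₁ x))
      atTop (𝓝 0))
    (hlim₂ : Tendsto (fun x : ℝ => Complex.exp (-(Complex.I) * x * ξ) * f₂ x) atTop (𝓝 1))
    (hlim₂' : Tendsto (deriv (fun x : ℝ => Complex.exp (-(Complex.I) * x * ξ) * f₂ x))
      atTop (𝓝 0)) :
    f₁ = f₂ := by
  have hd₁ : ∀ x, HasDerivAt f₁ (deriv f₁ x) x := fun x =>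
    (hf₁.differentiable (by norm_num) x).hasDerivAt
  have hd₂ : ∀ x, HasDerivAt f₂ (deriv f₂ x) x := fun x =>
    (hf₂.differentiable (by norm_num) x).hasDerivAt
  have hdd : ∀ f : ℝ → ℂ, ContDiff ℝ 2 f → ∀ x, HasDerivAt (deriv f) (deriv (deriv f) x) x :=
    fun f hf x => ((hf.differentiable_deriv_two) x).hasDerivAt
  have hg : ∀ x, HasDerivAt (fun x => f₁ x - f₂ x) (deriv f₁ x - deriv f₂ x) x :=
    fun x => (hd₁ x).sub (hd₂ x)
  have hh : ∀ x, HasDerivAt (fun x => deriv f₁ x - deriv f₂ x)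
      (((V x : ℂ) - (ξ : ℂ) ^ 2) * (f₁ x - f₂ x)) x := fun x => by
    refine ((hdd f₁ hf₁ x).sub (hdd f₂ hf₂ x)).congr_deriv ?_
    linear_combination heq₂ x - heq₁ x
  have hnorm : ∀ x : ℝ, ‖Complex.exp (-(Complex.I) * x * ξ)‖ = 1 := fun x => by
    simp [Complex.norm_exp]
  have hder : ∀ f : ℝ → ℂ, (∀ x, HasDerivAt f (deriv f x) x) →
      deriv (fun x : ℝ => Complex.exp (-(Complex.I) * x * ξ) * f x) =
        fun x : ℝ => Complex.exp (-(Complex.I) * x * ξ) * (deriv f x - Complex.I * ξ * f x) := by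
    intro f hf
    ext x
    have he := (((Complex.ofRealCLM.hasDerivAt (x := x)).const_mul
      (-Complex.I)).mul_const (ξ : ℂ)).cexp
    refine ((he.mul (hf x)).congr_deriv ?_).deriv
    simp only [Complex.ofRealCLM_apply, Complex.ofReal_one]
    ring
  rw [hder f₁ hd₁] at hlim₁'
  rw [hder f₂ hd₂] at hlim₂'
  have hlim : Tendsto (fun x => f₁ x - f₂ x) atTop (𝓝 0) := by
    have := hlim₁.sub hlim₂
    rw [sub_self, tendsto_zero_iff_norm_tendsto_zero] at this
    rw [tendsto_zero_iff_norm_tendsto_zero]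
    simpa only [← mul_sub, norm_mul, hnorm, one_mul] using this
  have hlim' : Tendsto (fun x => (deriv f₁ x - deriv f₂ x) - Complex.I * ξ * (f₁ x - f₂ x))
      atTop (𝓝 0) := by
    have := hlim₁'.sub hlim₂'
    rw [sub_self, tendsto_zero_iff_norm_tendsto_zero] at this
    rw [tendsto_zero_iff_norm_tendsto_zero]
    refine this.congr fun x => ?_
    rw [← mul_sub, norm_mul, hnorm, one_mul]
    congr 1
    ring
  obtain ⟨a, ha⟩ := exists_eq_zero_of_tendsto_zero hV hVint hg hh hlim hlim'
  have hzero := eq_zero_of_eq_zero_on_Ici (q := fun x => (V x : ℂ) - (ξ : ℂ) ^ 2)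
    (by fun_prop) hg hh ha
  ext x
  exact sub_eq_zero.1 (congrFun hzero x)
end

section
/- Let V : ℝ → ℝ be continuously differentiable with ∫_ℝ (1+|y|)(|V(y)| + |V'(y)|) dy < ∞. Then there exists a constant C, depending only on V, with the following property: for every ξ ∈ ℝ and every pair of twice continuously differentiable functions f₊, f₋ : ℝ → ℂ such that −f₊'' + V f₊ = ξ² f₊ and −f₋'' + V f₋ = ξ² f₋ on ℝ, e^{−ixξ} f₊(x) → 1 and (d/dx)(e^{−ixξ} f₊(x)) → 0 as x → +∞, and e^{ixξ} f₋(x) → 1 and (d/dx)(e^{ixξ} f₋(x)) → 0 as x → −∞, the Wronskian W(ξ) := f₊(0) f₋'(0) − f₊'(0) f₋(0) satisfies |W(ξ) + 2iξ| ≤ C. -/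
open MeasureTheory Filter Topology

/-- The tail integral of a continuous function is differentiable. -/
lemma hasDerivAt_integral_Ioi {φ : ℝ → ℝ} (hφ : Continuous φ)
    (hint : IntegrableOn φ (Set.Ioi 0)) (x : ℝ) :
    HasDerivAt (fun y => ∫ t in Set.Ioi y, φ t) (-φ x) x := by
  have hEq : (fun y => ∫ t in Set.Ioi y, φ t)
      = fun y => (∫ t in Set.Ioi 0, φ t) - ∫ t in (0 : ℝ)..y, φ t := by
    funext y
    have h : IntegrableOn φ (Set.Ioi y) := by
      have hsub : Set.Ioi y ⊆ Set.Icc y 0 ∪ Set.Ioi 0 := fun t ht => by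
        rcases le_or_gt t 0 with h | h
        · exact Or.inl ⟨le_of_lt ht, h⟩
        · exact Or.inr h
      exact ((hφ.integrableOn_Icc).union hint).mono_set hsub
    rw [← intervalIntegral.integral_interval_add_Ioi hint h]
    ring
  rw [hEq]
  simpa using (hφ.integral_hasStrictDerivAt 0 x).hasDerivAt.const_sub (∫ t in Set.Ioi 0, φ t)

/-- A function whose speed is dominated by the decay rate of a nonnegative function `B`
is within `B` of its limit at infinity. -/
lemma norm_sub_le_of_norm_deriv_le {f f' : ℝ → ℂ} {B B' : ℝ → ℝ} {l : ℂ}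
    (hf : ∀ x, HasDerivAt f (f' x) x) (hB : ∀ x, HasDerivAt B (-B' x) x)
    (hle : ∀ x, 0 ≤ x → ‖f' x‖ ≤ B' x) (hB0 : ∀ x, 0 ≤ x → 0 ≤ B x)
    (hl : Tendsto f atTop (𝓝 l)) {x : ℝ} (hx : 0 ≤ x) : ‖f x - l‖ ≤ B x := by
  have key : ∀ y, x ≤ y → ‖f x - f y‖ ≤ B x := by
    intro y hy
    have h := image_norm_le_of_norm_deriv_right_le_deriv_boundary
      (f := fun t => f x - f t) (f' := fun t => -f' t) (B := fun t => B x - B t)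
      (B' := B') (a := x) (b := y)
      (fun t _ => ((hf t).const_sub (f x)).continuousAt.continuousWithinAt)
      (fun t _ => ((hf t).const_sub (f x)).hasDerivWithinAt) (by simp)
      (fun t => by simpa using (hB t).const_sub (B x))
      (fun t ht => by simpa using hle t (hx.trans ht.1)) (Set.right_mem_Icc.2 hy)
    have := hB0 y (hx.trans hy)
    linarith
  exact le_of_tendsto (hl.const_sub (f x)).norm ((eventually_ge_atTop x).mono key)

/-- Bounds at the origin, uniform in `ξ`, for the normalized Jost function `m`, which solves
`m'' + 2iξm' = Vm` with `m → 1` and `m' → 0` at infinity. -/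
lemma normalized_jost_bounds {V : ℝ → ℝ} (hV : Continuous V)
    (hVint : IntegrableOn (fun t => (1 + t) * |V t|) (Set.Ioi 0)) {ξ : ℝ} {m n : ℝ → ℂ}
    (hm : ∀ x, HasDerivAt m (n x) x)
    (hn : ∀ x, HasDerivAt n (V x * m x - 2 * Complex.I * ξ * n x) x)
    (hm1 : Tendsto m atTop (𝓝 1)) (hn0 : Tendsto n atTop (𝓝 0)) :
    ‖m 0‖ ≤ Real.exp (∫ t in Set.Ioi 0, (1 + t) * |V t|) ∧
      ‖n 0‖ ≤ Real.exp (∫ t in Set.Ioi 0, (1 + t) * |V t|) ∧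
      ‖2 * Complex.I * ξ * (m 0 - 1)‖ ≤
        2 * Real.exp (∫ t in Set.Ioi 0, (1 + t) * |V t|) := by
  have hmc : Continuous m := continuous_iff_continuousAt.2 fun x => (hm x).continuousAt
  have hφc : Continuous fun t => |V t| * ‖m t‖ := by fun_prop
  have hψc : Continuous fun t => (1 + t) * (|V t| * ‖m t‖) := by fun_prop
  have hwc : Continuous fun t => (1 + t) * |V t| := by fun_prop
  have hψi : IntegrableOn (fun t => (1 + t) * (|V t| * ‖m t‖)) (Set.Ioi 0) := by
    have hO : (fun t => (1 + t) * (|V t| * ‖m t‖)) =O[atTop] fun t => (1 + t) * |V t| := by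
      have h := (Asymptotics.isBigO_refl (fun t => (1 + t) * |V t|) atTop).mul
        (hm1.norm.isBigO_one ℝ)
      simpa [mul_assoc] using h
    exact ((hψc.locallyIntegrable.locallyIntegrableOn _).integrableOn_of_isBigO_atTop hO
      ⟨Set.Ioi 0, Ioi_mem_atTop 0, hVint⟩).mono_set Set.Ioi_subset_Ici_self
  have hφi : IntegrableOn (fun t => |V t| * ‖m t‖) (Set.Ioi 0) := by
    refine Integrable.mono' hψi hφc.aestronglyMeasurable ?_
    filter_upwards [ae_restrict_mem measurableSet_Ioi] with t ht
    have ht : (0 : ℝ) < t := ht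
    have : 0 ≤ |V t| * ‖m t‖ := by positivity
    rw [Real.norm_of_nonneg this]
    nlinarith
  set N : ℝ → ℝ := fun x => ∫ t in Set.Ioi x, |V t| * ‖m t‖ with hN
  set K : ℝ → ℝ := fun x => ∫ t in Set.Ioi x, (1 + t) * (|V t| * ‖m t‖) with hK
  set w : ℝ → ℝ := fun x => ∫ t in Set.Ioi x, (1 + t) * |V t| with hw
  have hN' := hasDerivAt_integral_Ioi hφc hφi
  have hK' := hasDerivAt_integral_Ioi hψc hψi
  have hw' := hasDerivAt_integral_Ioi hwc hVint
  have hN0 : ∀ x, 0 ≤ x → 0 ≤ N x := fun x _ => integral_nonneg fun t => by positivity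
  have hNK : ∀ x, 0 ≤ x → (1 + x) * N x ≤ K x := by
    intro x hx
    rw [hN, hK, ← integral_const_mul]
    refine setIntegral_mono_on ((hφi.mono_set (Set.Ioi_subset_Ioi hx)).const_mul _)
      (hψi.mono_set (Set.Ioi_subset_Ioi hx)) measurableSet_Ioi fun t ht => ?_
    have ht : x < t := ht
    gcongr
  have hnN : ∀ x, 0 ≤ x → ‖n x‖ ≤ N x := by
    intro x hx
    have hexp (t : ℝ) : ‖Complex.exp (2 * Complex.I * ξ * t)‖ = 1 := by
      rw [Complex.norm_exp]; simp
    have hd (t : ℝ) : HasDerivAt (fun t : ℝ => Complex.exp (2 * Complex.I * ξ * t) * n t)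
        (Complex.exp (2 * Complex.I * ξ * t) * (V t * m t)) t := by
      have h1 : HasDerivAt (fun t : ℝ => 2 * Complex.I * ξ * (t : ℂ))
          (2 * Complex.I * ξ) t := by
        simpa using (Complex.ofRealCLM.hasDerivAt (x := t)).const_mul (2 * Complex.I * (ξ : ℂ))
      exact (h1.cexp.mul (hn t)).congr_deriv (by ring)
    have h := norm_sub_le_of_norm_deriv_le (l := 0) hd hN'
      (fun t _ => by simp [hexp]) hN0
      (by
        rw [tendsto_zero_iff_norm_tendsto_zero] at hn0 ⊢
        simpa [hexp] using hn0) hx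
    simpa [hexp] using h
  have hmK : ∀ x, 0 ≤ x → ‖m x‖ ≤ 1 + K x := by
    intro x hx
    have h := norm_sub_le_of_norm_deriv_le (l := 1) (B := fun x => K x - (1 + x) * N x)
      (B' := N) hm
      (fun t => ((hK' t).sub (((hasDerivAt_id t).const_add 1).mul (hN' t))).congr_deriv
        (by simp only [id]; ring))
      hnN (fun t ht => sub_nonneg.2 (hNK t ht)) hm1 hx
    have h1 := norm_sub_norm_le (m x) 1
    have h2 : 0 ≤ (1 + x) * N x := mul_nonneg (by linarith) (hN0 x hx)
    simp only [norm_one] at h1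
    linarith
  have hK0 : 1 + K 0 ≤ Real.exp (w 0) := by
    have hmono : MonotoneOn (fun x => (1 + K x) * Real.exp (-w x)) (Set.Ici 0) := by
      have hd (x : ℝ) : HasDerivAt (fun x => (1 + K x) * Real.exp (-w x))
          (((1 + x) * |V x| * Real.exp (-w x)) * (1 + K x - ‖m x‖)) x :=
        (((hK' x).const_add 1).mul (hw' x).neg.exp).congr_deriv (by
          simp only [Pi.neg_apply, hw, hK]
          ring)
      refine monotoneOn_of_deriv_nonneg (convex_Ici 0)
        (fun x _ => (hd x).continuousAt.continuousWithinAt)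
        (fun x _ => (hd x).differentiableAt.differentiableWithinAt) fun x hx => ?_
      have hx : (0 : ℝ) < x := by simpa using hx
      rw [(hd x).deriv]
      have := hmK x hx.le
      exact mul_nonneg (by positivity) (by linarith)
    have hlim : Tendsto (fun x => (1 + K x) * Real.exp (-w x)) atTop (𝓝 1) := by
      have h (φ : ℝ → ℝ) : Tendsto (fun x => ∫ t in Set.Ioi x, φ t) atTop (𝓝 0) :=
        tendsto_integral_Ioi_zero tendsto_id
      simpa using ((h fun t => (1 + t) * (|V t| * ‖m t‖)).const_add 1).mul
        (h fun t => (1 + t) * |V t|).neg.rexp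
    have h0 : (1 + K 0) * Real.exp (-w 0) ≤ 1 :=
      ge_of_tendsto hlim ((eventually_ge_atTop 0).mono fun x hx =>
        hmono Set.self_mem_Ici hx hx)
    rwa [Real.exp_neg, ← div_eq_mul_inv, div_le_one (Real.exp_pos _)] at h0
  have hN0K : N 0 ≤ K 0 := by simpa using hNK 0 le_rfl
  have hn0N := hnN 0 le_rfl
  refine ⟨(hmK 0 le_rfl).trans hK0, by linarith, ?_⟩
  have hg := norm_sub_le_of_norm_deriv_le (l := 0)
    (f := fun x => n x + 2 * Complex.I * ξ * (m x - 1)) (f' := fun x => V x * m x)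
    (fun x => ((hn x).add (((hm x).sub_const 1).const_mul (2 * Complex.I * (ξ : ℂ)))).congr_deriv
      (by ring)) hN' (fun t _ => by simp) hN0
    (by simpa using hn0.add ((hm1.sub_const 1).const_mul (2 * Complex.I * (ξ : ℂ)))) le_rfl
  rw [sub_zero] at hg
  have h := norm_sub_le (n 0 + 2 * Complex.I * ξ * (m 0 - 1)) (n 0)
  rw [add_sub_cancel_left] at h
  linarith

/-- Bounds at the origin, uniform in `ξ`, for the right Jost solution. -/
lemma jost_bounds {V : ℝ → ℝ} (hV : Continuous V)
    (hVint : IntegrableOn (fun t => (1 + t) * |V t|) (Set.Ioi 0)) {ξ : ℝ} {f : ℝ → ℂ}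
    (hf : ContDiff ℝ 2 f)
    (hode : ∀ x : ℝ, -(deriv (deriv f) x) + (V x : ℂ) * f x = (ξ : ℂ) ^ 2 * f x)
    (h1 : Tendsto (fun x : ℝ => Complex.exp (-(Complex.I) * x * ξ) * f x) atTop (𝓝 1))
    (h0 : Tendsto (deriv (fun x : ℝ => Complex.exp (-(Complex.I) * x * ξ) * f x)) atTop (𝓝 0)) :
    ‖f 0‖ ≤ Real.exp (∫ t in Set.Ioi 0, (1 + t) * |V t|) ∧
      ‖deriv f 0 - Complex.I * ξ * f 0‖ ≤ Real.exp (∫ t in Set.Ioi 0, (1 + t) * |V t|) ∧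
      ‖2 * Complex.I * ξ * (f 0 - 1)‖ ≤
        2 * Real.exp (∫ t in Set.Ioi 0, (1 + t) * |V t|) := by
  have hf1 (x : ℝ) : HasDerivAt f (deriv f x) x := (hf.differentiable (by norm_num) x).hasDerivAt
  have hf2 (x : ℝ) : HasDerivAt (deriv f) (deriv (deriv f) x) x :=
    (hf.differentiable_deriv_two x).hasDerivAt
  have he (x : ℝ) : HasDerivAt (fun x : ℝ => Complex.exp (-(Complex.I) * x * ξ))
      (Complex.exp (-(Complex.I) * x * ξ) * (-Complex.I * ξ)) x := by
    have h : HasDerivAt (fun x : ℝ => -Complex.I * (x : ℂ) * ξ) (-Complex.I * ξ) x := by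
      simpa using ((Complex.ofRealCLM.hasDerivAt (x := x)).const_mul (-Complex.I)).mul_const (ξ : ℂ)
    exact h.cexp
  have hm (x : ℝ) : HasDerivAt (fun x : ℝ => Complex.exp (-(Complex.I) * x * ξ) * f x)
      (Complex.exp (-(Complex.I) * x * ξ) * (deriv f x - Complex.I * ξ * f x)) x :=
    ((he x).mul (hf1 x)).congr_deriv (by ring)
  have hn (x : ℝ) := ((he x).mul ((hf2 x).sub ((hf1 x).const_mul (Complex.I * ξ)))).congr_deriv
    (g' := V x * (Complex.exp (-(Complex.I) * x * ξ) * f x) - 2 * Complex.I * ξ *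
      (Complex.exp (-(Complex.I) * x * ξ) * (deriv f x - Complex.I * ξ * f x)))
    (by
      simp only [Pi.sub_apply]
      linear_combination (-Complex.exp (-(Complex.I) * x * ξ)) * hode x
        - Complex.exp (-(Complex.I) * x * ξ) * ξ ^ 2 * f x * Complex.I_sq)
  rw [funext fun x => (hm x).deriv] at h0
  simpa using normalized_jost_bounds hV hVint hm hn h1 h0

/-- Large-frequency asymptotics of the Wronskian of the Jost solutions:
`W(ξ) = −2iξ + O(1)`, i.e. there is a constant `C = C(V)` such that for all `ξ` and all
Jost solutions `f₊(·, ξ)`, `f₋(·, ξ)` one has `|W(ξ) + 2iξ| ≤ C`, where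
`W(ξ) = f₊(0) f₋'(0) − f₊'(0) f₋(0)`. -/
theorem wronskian_asymptotics
    (V : ℝ → ℝ) (hV : ContDiff ℝ 1 V)
    (hVint : Integrable (fun y : ℝ => (1 + |y|) * (|V y| + |deriv V y|))) :
    ∃ C : ℝ, ∀ ξ : ℝ, ∀ fp fm : ℝ → ℂ,
      ContDiff ℝ 2 fp → ContDiff ℝ 2 fm →
      (∀ x : ℝ, -(deriv (deriv fp) x) + (V x : ℂ) * fp x = (ξ : ℂ) ^ 2 * fp x) →
      (∀ x : ℝ, -(deriv (deriv fm) x) + (V x : ℂ) * fm x = (ξ : ℂ) ^ 2 * fm x) →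
      Tendsto (fun x : ℝ => Complex.exp (-(Complex.I) * x * ξ) * fp x) atTop (𝓝 1) →
      Tendsto (deriv (fun x : ℝ => Complex.exp (-(Complex.I) * x * ξ) * fp x)) atTop (𝓝 0) →
      Tendsto (fun x : ℝ => Complex.exp (Complex.I * x * ξ) * fm x) atBot (𝓝 1) →
      Tendsto (deriv (fun x : ℝ => Complex.exp (Complex.I * x * ξ) * fm x)) atBot (𝓝 0) →
      ‖(fp 0 * deriv fm 0 - deriv fp 0 * fm 0) + 2 * Complex.I * ξ‖ ≤ C := by
  have hVc := hV.continuous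
  have hI : Integrable fun y : ℝ => (1 + |y|) * |V y| := by
    refine hVint.mono' (by fun_prop) (ae_of_all _ fun y => ?_)
    rw [Real.norm_of_nonneg (by positivity)]
    gcongr
    linarith [abs_nonneg (deriv V y)]
  have hp : IntegrableOn (fun t => (1 + t) * |V t|) (Set.Ioi 0) :=
    hI.integrableOn.congr_fun (fun t (ht : 0 < t) => by simp [abs_of_pos ht]) measurableSet_Ioi
  have hq : IntegrableOn (fun t => (1 + t) * |V (-t)|) (Set.Ioi 0) :=
    hI.comp_neg.integrableOn.congr_fun (fun t (ht : 0 < t) => by simp [abs_of_pos ht])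
      measurableSet_Ioi
  set P := Real.exp (∫ t in Set.Ioi 0, (1 + t) * |V t|)
  set Q := Real.exp (∫ t in Set.Ioi 0, (1 + t) * |V (-t)|)
  refine ⟨2 * P * Q + 2 * Q + P * Q + P * Q, ?_⟩
  intro ξ fp fm hfp hfm hode hode' h1 h0 h1' h0'
  obtain ⟨a1, a2, a3⟩ := jost_bounds hVc hp hfp hode h1 h0
  have hd1 : deriv (fun x => fm (-x)) = fun x => -deriv fm (-x) :=
    funext fun x => deriv_comp_neg fm x
  have hd2 (x : ℝ) : deriv (deriv fun x => fm (-x)) x = deriv (deriv fm) (-x) := by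
    rw [hd1, deriv.fun_neg, deriv_comp_neg (deriv fm), neg_neg]
  have hrefl : (fun x : ℝ => Complex.exp (-(Complex.I) * x * ξ) * fm (-x))
      = fun x => (fun x : ℝ => Complex.exp (Complex.I * x * ξ) * fm x) (-x) := by
    funext x
    simp
  obtain ⟨b1, b2, b3⟩ := jost_bounds (V := fun t => V (-t)) (f := fun x => fm (-x)) (ξ := ξ)
    (by fun_prop) hq (by fun_prop) (fun x => by rw [hd2]; exact hode' (-x))
    (by rw [hrefl]; exact h1'.comp tendsto_neg_atTop_atBot)
    (by
      rw [hrefl, funext fun x =>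
        deriv_comp_neg (fun x : ℝ => Complex.exp (Complex.I * x * ξ) * fm x) x]
      simpa using (h0'.comp tendsto_neg_atTop_atBot).neg)
  rw [hd1] at b2
  simp only [neg_zero] at b1 b2 b3
  have hsplit : fp 0 * deriv fm 0 - deriv fp 0 * fm 0 + 2 * Complex.I * ξ
      = -(2 * Complex.I * ξ * (fp 0 - 1) * fm 0) - 2 * Complex.I * ξ * (fm 0 - 1)
        - fp 0 * (-deriv fm 0 - Complex.I * ξ * fm 0)
        - (deriv fp 0 - Complex.I * ξ * fp 0) * fm 0 := by ring
  rw [hsplit]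
  refine norm_sub_le_of_le (norm_sub_le_of_le (norm_sub_le_of_le ?_ b3) ?_) ?_
  · rw [norm_neg]
    exact norm_mul_le_of_le a3 b1
  · exact norm_mul_le_of_le a1 b2
  · exact norm_mul_le_of_le a2 b1
end

section
/- Both improper integrals I₊ := ∫_ℝ e^{i√3 x} (i√3 − tanh x) (sinh³x / cosh⁴x) dx and I₋ := ∫_ℝ e^{−i√3 x} (−i√3 − tanh x) (sinh³x / cosh⁴x) dx vanish: I₊ = I₋ = 0. -/
open MeasureTheory Filter Topology

lemma one_add_sq_div_four_le_cosh (x : ℝ) : 1 + x ^ 2 / 4 ≤ Real.cosh x := by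
  rw [← Real.cosh_abs, ← sq_abs, Real.cosh_eq]
  linarith [Real.quadratic_le_exp_of_nonneg (abs_nonneg x), Real.add_one_le_exp (-|x|)]

lemma inv_cosh_le (x : ℝ) : (Real.cosh x)⁻¹ ≤ 4 * (1 + x ^ 2)⁻¹ := by
  rw [← div_eq_mul_inv, inv_le_iff_one_le_mul₀ (Real.cosh_pos x), div_mul_eq_mul_div,
    le_div_iff₀ (by positivity)]
  linarith [one_add_sq_div_four_le_cosh x]

lemma integrable_inv_cosh : Integrable fun x : ℝ ↦ (Real.cosh x)⁻¹ := by
  refine (integrable_inv_one_add_sq.const_mul 4).mono'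
    (Real.continuous_cosh.inv₀ fun x ↦ (Real.cosh_pos x).ne').aestronglyMeasurable ?_
  filter_upwards with x
  rw [Real.norm_of_nonneg (inv_nonneg.2 (Real.cosh_pos x).le)]
  exact inv_cosh_le x

lemma tendsto_inv_cosh_cocompact :
    Tendsto (fun x : ℝ ↦ (Real.cosh x)⁻¹) (cocompact ℝ) (𝓝 0) := by
  refine tendsto_inv_atTop_zero.comp (tendsto_atTop_mono (f := fun x ↦ ‖x‖) (fun x ↦ ?_)
    (tendsto_norm_cocompact_atTop (E := ℝ)))
  rw [Real.norm_eq_abs]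
  nlinarith [one_add_sq_div_four_le_cosh x, sq_nonneg (|x| - 2), sq_abs x]

lemma Real.hasDerivAt_tanh_one_sub_sq (x : ℝ) :
    HasDerivAt Real.tanh (1 - Real.tanh x ^ 2) x := by
  have hc := (Real.cosh_pos x).ne'
  rw [funext Real.tanh_eq_sinh_div_cosh]
  refine ((Real.hasDerivAt_sinh x).div (Real.hasDerivAt_cosh x) hc).congr_deriv ?_
  field_simp

lemma norm_cexp_I_mul_ofReal_mul (s x : ℝ) : ‖Complex.exp (Complex.I * s * x)‖ = 1 := by
  rw [Complex.norm_exp]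
  simp

/-- For `s ^ 2 = 3` the integrand has an antiderivative in closed form. -/
lemma hasDerivAt_nonresonance_primitive {s : ℝ} (hs : s ^ 2 = 3) (x : ℝ) :
    HasDerivAt (fun y : ℝ ↦ Complex.exp (Complex.I * s * y) *
        (((Real.tanh y ^ 3 + 3 * Real.tanh y : ℝ) : ℂ) +
          Complex.I * s * ((1 - Real.tanh y ^ 2 : ℝ) : ℂ)) / 4 * ((Real.cosh y)⁻¹ : ℝ))
      (Complex.exp (Complex.I * s * x) * (Complex.I * s - (Real.tanh x : ℂ)) *
        ((Real.sinh x ^ 3 / Real.cosh x ^ 4 : ℝ) : ℂ)) x := by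
  have hc := (Real.cosh_pos x).ne'
  have hT := Real.hasDerivAt_tanh_one_sub_sq x
  have hE : HasDerivAt (fun y : ℝ ↦ Complex.exp (Complex.I * s * y))
      (Complex.exp (Complex.I * s * x) * (Complex.I * s)) x := by
    simpa using ((hasDerivAt_id x).ofReal_comp.const_mul (Complex.I * s)).cexp
  have hodd := ((hT.pow 3).add (hT.const_mul 3)).ofReal_comp
  have heven := ((hT.pow 2).const_sub 1).ofReal_comp.const_mul (Complex.I * (s : ℂ))
  have hS := ((Real.hasDerivAt_cosh x).inv hc).ofReal_comp
  refine (((hE.mul (hodd.add heven)).div_const 4).mul hS).congr_deriv ?_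
  have hsinh : Real.sinh x = Real.tanh x * Real.cosh x := by
    rw [Real.tanh_eq_sinh_div_cosh, div_mul_cancel₀ _ hc]
  have ha : (Complex.I * s) ^ 2 = -3 := by
    rw [mul_pow, Complex.I_sq, show (s : ℂ) ^ 2 = 3 by exact_mod_cast hs, neg_one_mul]
  have hc' : (Real.cosh x : ℂ) ≠ 0 := by exact_mod_cast hc
  simp only [hsinh, Pi.add_apply, Pi.mul_apply, Pi.pow_apply, Pi.inv_apply]
  generalize Complex.I * (s : ℂ) = a at *
  generalize Real.tanh x = t at *
  generalize Real.cosh x = c at *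
  push_cast
  field_simp
  linear_combination (1 - (t : ℂ) ^ 2) * ha

lemma integral_nonresonance_eq_zero {s : ℝ} (hs : s ^ 2 = 3) :
    ∫ x : ℝ, Complex.exp (Complex.I * s * x) * (Complex.I * s - (Real.tanh x : ℂ)) *
        ((Real.sinh x ^ 3 / Real.cosh x ^ 4 : ℝ) : ℂ) = 0 := by
  have htanh (x : ℝ) : |Real.tanh x| ≤ 1 := (Real.abs_tanh_lt_one x).le
  have hint : Integrable fun x : ℝ ↦
      Complex.exp (Complex.I * s * x) * (Complex.I * s - (Real.tanh x : ℂ)) *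
        ((Real.sinh x ^ 3 / Real.cosh x ^ 4 : ℝ) : ℂ) := by
    refine (integrable_inv_cosh.const_mul (|s| + 1)).mono' ?_ ?_
    · have hcont : Continuous Real.tanh := continuous_iff_continuousAt.2 fun x ↦
        (Real.hasDerivAt_tanh_one_sub_sq x).continuousAt
      have hquot : Continuous fun x ↦ Real.sinh x ^ 3 / Real.cosh x ^ 4 :=
        (Real.continuous_sinh.pow 3).div (Real.continuous_cosh.pow 4) fun x ↦
          (pow_pos (Real.cosh_pos x) 4).ne'
      exact Continuous.aestronglyMeasurable (by fun_prop)
    · filter_upwards with x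
      have hquot : Real.sinh x ^ 3 / Real.cosh x ^ 4 = Real.tanh x ^ 3 * (Real.cosh x)⁻¹ := by
        rw [Real.tanh_eq_sinh_div_cosh]
        field_simp
      rw [norm_mul, norm_mul, norm_cexp_I_mul_ofReal_mul, one_mul, hquot, Complex.norm_real,
        norm_mul, Real.norm_of_nonneg (inv_nonneg.2 (Real.cosh_pos x).le), ← mul_assoc]
      have h1 : ‖Complex.I * s - (Real.tanh x : ℂ)‖ ≤ |s| + 1 := by
        refine (norm_sub_le _ _).trans ?_
        rw [norm_mul, Complex.norm_I, one_mul, Complex.norm_real, Complex.norm_real]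
        exact add_le_add_right (htanh x) _
      have h2 : ‖Real.tanh x ^ 3‖ ≤ 1 := by
        rw [norm_pow]
        exact pow_le_one₀ (norm_nonneg _) (htanh x)
      refine mul_le_mul_of_nonneg_right ?_ (inv_nonneg.2 (Real.cosh_pos x).le)
      simpa using mul_le_mul h1 h2 (norm_nonneg _) (by positivity)
  have hlim : Tendsto (fun y : ℝ ↦ Complex.exp (Complex.I * s * y) *
        (((Real.tanh y ^ 3 + 3 * Real.tanh y : ℝ) : ℂ) +
          Complex.I * s * ((1 - Real.tanh y ^ 2 : ℝ) : ℂ)) / 4 * ((Real.cosh y)⁻¹ : ℝ))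
      (cocompact ℝ) (𝓝 0) := by
    have h := tendsto_inv_cosh_cocompact.const_mul (4 + |s|)
    rw [mul_zero] at h
    refine squeeze_zero_norm (fun x ↦ ?_) h
    obtain ⟨hl, hr⟩ := abs_le.1 (htanh x)
    rw [norm_mul, norm_div, norm_mul, norm_cexp_I_mul_ofReal_mul, one_mul, Complex.norm_real,
      Real.norm_of_nonneg (inv_nonneg.2 (Real.cosh_pos x).le)]
    refine mul_le_mul_of_nonneg_right ?_ (inv_nonneg.2 (Real.cosh_pos x).le)
    have h1 : |Real.tanh x ^ 3 + 3 * Real.tanh x| ≤ 4 := by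
      rw [abs_le]
      constructor <;> nlinarith [sq_nonneg (Real.tanh x), sq_nonneg (Real.tanh x + 1),
        sq_nonneg (Real.tanh x - 1)]
    have h2 : |1 - Real.tanh x ^ 2| ≤ 1 := by
      rw [abs_le]
      constructor <;> nlinarith
    have h3 := norm_add_le ((Real.tanh x ^ 3 + 3 * Real.tanh x : ℝ) : ℂ)
      (Complex.I * s * ((1 - Real.tanh x ^ 2 : ℝ) : ℂ))
    rw [norm_mul, norm_mul, Complex.norm_I, one_mul, Complex.norm_real, Complex.norm_real,
      Complex.norm_real, Real.norm_eq_abs, Real.norm_eq_abs, Real.norm_eq_abs] at h3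
    have h4 := mul_le_mul_of_nonneg_left h2 (abs_nonneg s)
    rw [show ‖(4 : ℂ)‖ = 4 by simp, div_le_iff₀ (by norm_num)]
    linarith [abs_nonneg s]
  rw [integral_of_hasDerivAt_of_tendsto (hasDerivAt_nonresonance_primitive hs) hint
    (hlim.mono_left atBot_le_cocompact) (hlim.mono_left atTop_le_cocompact), sub_zero]

/-- The non-resonance identity for the sine-Gordon kink: the integrals
`I_± = ∫_ℝ e^{±i√3 x} (±i√3 − tanh x) (sinh³ x / cosh⁴ x) dx` both vanish. -/
theorem sineGordon_nonresonance_integrals :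
    (∫ x : ℝ, Complex.exp (Complex.I * Real.sqrt 3 * x) *
        (Complex.I * Real.sqrt 3 - (Real.tanh x : ℂ)) *
        ((Real.sinh x ^ 3 / Real.cosh x ^ 4 : ℝ) : ℂ)) = 0 ∧
    (∫ x : ℝ, Complex.exp (-(Complex.I) * Real.sqrt 3 * x) *
        (-(Complex.I) * Real.sqrt 3 - (Real.tanh x : ℂ)) *
        ((Real.sinh x ^ 3 / Real.cosh x ^ 4 : ℝ) : ℂ)) = 0 := by
  have hsq : Real.sqrt 3 ^ 2 = 3 := Real.sq_sqrt (by norm_num)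
  refine ⟨integral_nonresonance_eq_zero hsq, ?_⟩
  have h := integral_nonresonance_eq_zero (s := -Real.sqrt 3) (by rw [neg_sq, hsq])
  simpa only [Complex.ofReal_neg, mul_neg, neg_mul] using h
end

section
/- For every radius r with 0 < r < π, the circle integral of the meromorphic function w ↦ e^{i√3 w} cosh³(w)/sinh⁴(w) over the circle |w| = r (oriented counterclockwise) equals 2πi · (i/√3) = −2π/√3. Equivalently, the residue at w = 0 of e^{i√3 w} cosh³(w)/sinh⁴(w) is i/√3. -/
theorem Complex.sinh_ne_zero_of_norm_lt_pi {w : ℂ} (h0 : w ≠ 0) (hw : ‖w‖ < Real.pi) :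
    Complex.sinh w ≠ 0 := by
  intro h
  have hs : Complex.sin (w * Complex.I) = 0 := by rw [Complex.sin_mul_I, h, zero_mul]
  obtain ⟨k, hk⟩ := Complex.sin_eq_zero_iff.1 hs
  have hn : ‖w‖ = |(k : ℝ)| * Real.pi := by
    have := congrArg norm hk
    simpa [abs_of_pos Real.pi_pos] using this
  rcases eq_or_ne k 0 with rfl | hk0
  · exact h0 (norm_eq_zero.1 (by simpa using hn))
  · have h1 : (1 : ℝ) ≤ |(k : ℝ)| := by exact_mod_cast Int.one_le_abs hk0
    nlinarith [Real.pi_pos]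

theorem circleIntegral_div_sinh {r : ℝ} (hr0 : 0 < r) (hrπ : r < Real.pi) {f : ℂ → ℂ}
    (hf : Differentiable ℂ f) :
    (∮ w in C(0, r), f w / Complex.sinh w) = 2 * Real.pi * Complex.I * f 0 := by
  have hd : Differentiable ℂ (dslope Complex.sinh 0) := by
    rw [← differentiableOn_univ, Complex.differentiableOn_dslope Filter.univ_mem]
    exact Complex.differentiable_sinh.differentiableOn
  have hd1 (w : ℂ) : w * dslope Complex.sinh 0 w = Complex.sinh w := by
    simpa using sub_smul_dslope Complex.sinh 0 w
  have hne (w : ℂ) (hw : w ∈ Metric.closedBall (0 : ℂ) r) : dslope Complex.sinh 0 w ≠ 0 := by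
    rcases eq_or_ne w 0 with rfl | h0
    · simp
    · exact right_ne_zero_of_mul ((hd1 w).symm ▸ Complex.sinh_ne_zero_of_norm_lt_pi h0
        ((mem_closedBall_zero_iff.1 hw).trans_lt hrπ))
  have key := (hf.differentiableOn.div hd.differentiableOn hne).circleIntegral_sub_inv_smul
    (Metric.mem_ball_self hr0)
  calc (∮ w in C(0, r), f w / Complex.sinh w)
      = ∮ w in C(0, r), (w - 0)⁻¹ • (f / dslope Complex.sinh 0) w := by
        refine circleIntegral.integral_congr hr0.le fun w _ ↦ ?_
        simp only [Pi.div_apply, sub_zero, smul_eq_mul, ← hd1 w, div_eq_mul_inv, mul_inv]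
        ring
    _ = 2 * Real.pi * Complex.I * f 0 := by rw [key]; simp

theorem hasDerivAt_primitive_exp_mul_cosh_cube_div_sinh_pow_four {a w : ℂ} (ha : a ^ 2 = -3)
    (hw : Complex.sinh w ≠ 0) :
    HasDerivAt (fun z ↦ Complex.exp (a * z) * (-1 / 3 / Complex.sinh z ^ 3
        - 1 / 2 / Complex.sinh z - a / 6 * Complex.cosh z / Complex.sinh z ^ 2))
      (Complex.exp (a * w) * Complex.cosh w ^ 3 / Complex.sinh w ^ 4
        - a / 3 * Complex.exp (a * w) / Complex.sinh w) w := by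
  have hs := Complex.hasDerivAt_sinh w
  have hc := Complex.hasDerivAt_cosh w
  have he := ((hasDerivAt_id w).const_mul a).cexp
  have h := he.mul ((((hasDerivAt_const w (-1 / 3 : ℂ)).div (hs.pow 3) (pow_ne_zero 3 hw)).sub
    ((hasDerivAt_const w (1 / 2 : ℂ)).div hs hw)).sub
    ((hc.const_mul (a / 6)).div (hs.pow 2) (pow_ne_zero 2 hw)))
  refine h.congr_deriv ?_
  have hcs := Complex.cosh_sq w
  simp only [id, Pi.pow_apply, Pi.sub_apply, Pi.div_apply]
  generalize Complex.exp (a * w) = e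
  generalize Complex.cosh w = c at *
  generalize Complex.sinh w = s at *
  have hc3 : c ^ 3 = c * (s ^ 2 + 1) := by rw [← hcs]; ring
  rw [hc3]
  field_simp
  ring_nf
  simp only [ha, hcs]
  ring

/-- The residue of `e^{i√3 w} cosh³ w / sinh⁴ w` at `w = 0` is `i/√3`: for `0 < r < π`,
the counterclockwise circle integral over `|w| = r` equals `2πi · (i/√3)`. -/
theorem residue_cosh3_sinh4 (r : ℝ) (hr0 : 0 < r) (hrπ : r < Real.pi) :
    (∮ w in C(0, r),
        Complex.exp (Complex.I * Real.sqrt 3 * w) * Complex.cosh w ^ 3 / Complex.sinh w ^ 4)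
      = 2 * Real.pi * Complex.I * (Complex.I / Real.sqrt 3) := by
  have h3 : (Real.sqrt 3 : ℂ) ^ 2 = 3 := by
    exact_mod_cast Real.sq_sqrt (show (0 : ℝ) ≤ 3 by norm_num)
  have h3' : (Real.sqrt 3 : ℂ) ≠ 0 := fun h ↦ by simp [h] at h3
  have ha : (Complex.I * Real.sqrt 3) ^ 2 = -3 := by rw [mul_pow, h3, Complex.I_sq]; ring
  have hres : Complex.I / Real.sqrt 3 = Complex.I * Real.sqrt 3 / 3 := by
    field_simp
    rw [h3]
  rw [hres]
  generalize Complex.I * (Real.sqrt 3 : ℂ) = a at *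
  have hs (w : ℂ) (hw : w ∈ Metric.sphere (0 : ℂ) r) : Complex.sinh w ≠ 0 := by
    rw [mem_sphere_zero_iff_norm] at hw
    exact Complex.sinh_ne_zero_of_norm_lt_pi (norm_pos_iff.1 (hw ▸ hr0)) (hw ▸ hrπ)
  have hprim := circleIntegral.integral_eq_zero_of_hasDerivWithinAt hr0.le fun w hw ↦
    (hasDerivAt_primitive_exp_mul_cosh_cube_div_sinh_pow_four ha (hs w hw)).hasDerivWithinAt
  have hi₁ : CircleIntegrable
      (fun w ↦ Complex.exp (a * w) * Complex.cosh w ^ 3 / Complex.sinh w ^ 4) 0 r :=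
    ContinuousOn.circleIntegrable hr0.le
      (ContinuousOn.div (by fun_prop) (by fun_prop) fun w hw ↦ pow_ne_zero 4 (hs w hw))
  have hi₂ : CircleIntegrable (fun w ↦ a / 3 * Complex.exp (a * w) / Complex.sinh w) 0 r :=
    ContinuousOn.circleIntegrable hr0.le (ContinuousOn.div (by fun_prop) (by fun_prop) hs)
  rw [circleIntegral.integral_sub hi₁ hi₂, sub_eq_zero] at hprim
  rw [hprim, circleIntegral_div_sinh hr0 hrπ (f := fun w ↦ a / 3 * Complex.exp (a * w))
    (by fun_prop)]
  simp
end

section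
/- Let F(z) := e^{i√3 z} (i√3 − tanh z) sinh³(z)/cosh⁴(z), a meromorphic function on ℂ with poles exactly at the points z_k = i(π/2)(2k+1), k ∈ ℤ. Then for every k ∈ ℤ and every radius r with 0 < r < π, the circle integral of F over the circle |z − z_k| = r (oriented counterclockwise) equals 0; that is, every residue of F vanishes. -/
/-- The zeros of `cosh` are the points `i(π/2)(2m+1)`. -/
theorem Complex.cosh_eq_zero_iff_exists_int {z : ℂ} :
    Complex.cosh z = 0 ↔ ∃ m : ℤ, z = Complex.I * (Real.pi / 2) * (2 * (m : ℂ) + 1) := by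
  have hI := Complex.I_mul_I
  rw [← Complex.cos_mul_I, Complex.cos_eq_zero_iff]
  constructor
  · rintro ⟨m, hm⟩
    refine ⟨-m - 1, ?_⟩
    push_cast
    linear_combination (-Complex.I) * hm + z * hI
  · rintro ⟨m, rfl⟩
    refine ⟨-m - 1, ?_⟩
    push_cast
    linear_combination (Real.pi / 2 : ℂ) * (2 * m + 1) * hI

/-- A circle of radius in `(0, π)` centered at a zero of `cosh` contains no zero of `cosh`. -/
theorem Complex.cosh_ne_zero_of_mem_sphere {k : ℤ} {r : ℝ} (hr0 : 0 < r) (hrπ : r < Real.pi)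
    {z : ℂ} (hz : z ∈ Metric.sphere (Complex.I * (Real.pi / 2) * (2 * (k : ℂ) + 1)) r) :
    Complex.cosh z ≠ 0 := by
  intro h
  obtain ⟨m, rfl⟩ := Complex.cosh_eq_zero_iff_exists_int.1 h
  have hsub : Complex.I * (Real.pi / 2) * (2 * (m : ℂ) + 1)
      - Complex.I * (Real.pi / 2) * (2 * (k : ℂ) + 1)
      = Complex.I * (Real.pi : ℂ) * ((m - k : ℤ) : ℂ) := by
    push_cast
    ring
  rw [mem_sphere_iff_norm, hsub, norm_mul, norm_mul, Complex.norm_I, one_mul,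
    Complex.norm_real, Real.norm_of_nonneg Real.pi_pos.le, Complex.norm_intCast] at hz
  rcases eq_or_ne (m - k) 0 with h0 | h0
  · simp [h0] at hz
    exact hr0.ne hz
  · have h1 : (1 : ℝ) ≤ |((m - k : ℤ) : ℝ)| := by
      exact_mod_cast Int.one_le_abs h0
    nlinarith [Real.pi_pos]

/-- With `a² = -3`, the function `e^{az} (a - tanh z) sinh³ z / cosh⁴ z` has an explicit
primitive, single-valued away from the zeros of `cosh`. -/
theorem Complex.hasDerivAt_sineGordon_primitive {a : ℂ} (ha : a ^ 2 = -3) {z : ℂ}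
    (hz : Complex.cosh z ≠ 0) :
    HasDerivAt
      (fun w => Complex.exp (a * w) *
        (Complex.sinh w ^ 3 - a * Complex.sinh w ^ 2 * Complex.cosh w +
          3 * Complex.sinh w * Complex.cosh w ^ 2 + a * Complex.cosh w ^ 3) /
        (4 * Complex.cosh w ^ 4))
      (Complex.exp (a * z) * (a - Complex.tanh z) * (Complex.sinh z ^ 3 / Complex.cosh z ^ 4))
      z := by
  have hs := Complex.hasDerivAt_sinh z
  have hc := Complex.hasDerivAt_cosh z
  have he : HasDerivAt (fun w => Complex.exp (a * w)) (Complex.exp (a * z) * (a * 1)) z :=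
    ((hasDerivAt_id z).const_mul a).cexp
  have hnum := (((hs.fun_pow 3).fun_sub (((hs.fun_pow 2).const_mul a).fun_mul hc)).fun_add
    ((hs.const_mul 3).fun_mul (hc.fun_pow 2))).fun_add ((hc.fun_pow 3).const_mul a)
  have hden : (4 * Complex.cosh z ^ 4 : ℂ) ≠ 0 := mul_ne_zero (by norm_num) (pow_ne_zero 4 hz)
  refine ((he.fun_mul hnum).fun_div ((hc.fun_pow 4).const_mul 4) hden).congr_deriv ?_
  rw [Complex.tanh_eq_sinh_div_cosh]
  field_simp
  push_cast
  linear_combination (Complex.cosh z ^ 7 - Complex.sinh z ^ 2 * Complex.cosh z ^ 5) * ha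

/-- All residues of `F(z) = e^{i√3 z} (i√3 − tanh z) sinh³ z / cosh⁴ z` vanish: for every
`k ∈ ℤ` and `0 < r < π`, the counterclockwise circle integral of `F` over the circle of
radius `r` centered at the pole `z_k = i(π/2)(2k+1)` equals `0`. -/
theorem residues_vanish_sineGordon (k : ℤ) (r : ℝ) (hr0 : 0 < r) (hrπ : r < Real.pi) :
    (∮ z in C(Complex.I * (Real.pi / 2) * (2 * (k : ℂ) + 1), r),
        Complex.exp (Complex.I * Real.sqrt 3 * z) *
          (Complex.I * Real.sqrt 3 - Complex.tanh z) *
          (Complex.sinh z ^ 3 / Complex.cosh z ^ 4)) = 0 := by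
  have ha : (Complex.I * (Real.sqrt 3 : ℂ)) ^ 2 = -3 := by
    rw [mul_pow, Complex.I_sq, ← Complex.ofReal_pow, Real.sq_sqrt (by norm_num)]
    norm_num
  exact circleIntegral.integral_eq_zero_of_hasDerivWithinAt hr0.le fun z hz =>
    (Complex.hasDerivAt_sineGordon_primitive ha
      (Complex.cosh_ne_zero_of_mem_sphere hr0 hrπ hz)).hasDerivWithinAt
end

section
/- Let a : ℝ → ℂ be four times continuously differentiable with compact support. Then there exists a constant C, depending on a, such that for all t ≥ 1: |∫_ℝ e^{it√(1+ξ²)} a(ξ) dξ − √(2π/t) · e^{iπ/4} e^{it} a(0)| ≤ C t^{−3/2}. -/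
open MeasureTheory

namespace StationaryPhase

open Filter Topology Complex FourierTransform

theorem norm_exp_neg_sub_one_le {z : ℂ} (hz : 0 ≤ z.re) : ‖cexp (-z) - 1‖ ≤ ‖z‖ := by
  have hderiv (w : ℂ) : HasDerivAt (fun w : ℂ ↦ cexp (-w)) (-cexp (-w)) w := by
    simpa using (hasDerivAt_neg w).cexp
  have h := Convex.norm_image_sub_le_of_norm_hasDerivWithin_le (𝕜 := ℂ)
    (s := {w : ℂ | 0 ≤ w.re}) (C := 1) (x := 0) (y := z)
    (fun w _ ↦ (hderiv w).hasDerivWithinAt)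
    (fun w (hw : 0 ≤ w.re) ↦ by simpa [Complex.norm_exp] using hw)
    (convex_halfSpace_re_ge 0) (by simp) hz
  simpa using h

/-- The Fourier transform of a compactly supported `C⁴` function is `O((1 + w²)⁻²)`. -/
theorem exists_norm_fourier_le {b : ℝ → ℂ} (hb : ContDiff ℝ 4 b) (hs : HasCompactSupport b) :
    ∃ M : ℝ, ∀ w : ℝ, (1 + w ^ 2) ^ 2 * ‖𝓕 b w‖ ≤ M := by
  have hsupp (n : ℕ) : HasCompactSupport (iteratedDeriv n b) := by
    induction n with
    | zero => simpa using hs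
    | succ n ih => rw [iteratedDeriv_succ]; exact ih.deriv
  have hint (n : ℕ) (hn : (n : ℕ∞) ≤ (4 : ℕ)) : Integrable (iteratedDeriv n b) :=
    (hb.continuous_iteratedDeriv n (by exact_mod_cast hn)).integrable_of_hasCompactSupport (hsupp n)
  have hnorm (f : ℝ → ℂ) (w : ℝ) : ‖𝓕 f w‖ ≤ ∫ x, ‖f x‖ :=
    VectorFourier.norm_fourierIntegral_le_integral_norm _ _ _ _ _
  refine ⟨2 * (∫ x, ‖b x‖) + 2 * ∫ x, ‖iteratedDeriv 4 b x‖, fun w ↦ ?_⟩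
  have h4 := hnorm (iteratedDeriv 4 b) w
  rw [Real.fourier_iteratedDeriv (N := (4 : ℕ)) (by exact_mod_cast hb) hint le_rfl] at h4
  have hw : ‖(2 * Real.pi * I * w : ℂ) ^ 4‖ = (2 * Real.pi) ^ 4 * w ^ 4 := by
    rw [norm_pow]
    simp only [norm_mul, norm_I, Complex.norm_real, Real.norm_eq_abs, abs_of_pos Real.pi_pos,
      Complex.norm_ofNat, mul_one]
    rw [mul_pow, ← abs_pow, abs_of_nonneg (by positivity)]
  rw [norm_smul, hw] at h4
  have hpi : 1 ≤ (2 * Real.pi) ^ 4 := one_le_pow₀ (by linarith [Real.pi_gt_three])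
  have h0 := hnorm b w
  have hF := norm_nonneg (𝓕 b w)
  have h4' : w ^ 4 * ‖𝓕 b w‖ ≤ ∫ x, ‖iteratedDeriv 4 b x‖ := by
    refine le_trans ?_ h4
    rw [mul_assoc]
    exact le_mul_of_one_le_left (by positivity) hpi
  nlinarith [mul_nonneg (sq_nonneg (w ^ 2 - 1)) hF]

theorem integrable_fourierInv {b : ℝ → ℂ} (hb : ContDiff ℝ 4 b) (hs : HasCompactSupport b) :
    Integrable (𝓕⁻ b) ∧ Integrable (fun w : ℝ ↦ w ^ 2 * ‖𝓕⁻ b w‖) := by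
  obtain ⟨M, hM⟩ := exists_norm_fourier_le hb hs
  have hcont : Continuous (𝓕⁻ b) := by
    have : Continuous (𝓕 b) := VectorFourier.fourierIntegral_continuous
      Real.continuous_fourierChar continuous_inner
      (hb.continuous.integrable_of_hasCompactSupport hs)
    rw [show 𝓕⁻ b = fun w ↦ 𝓕 b (-w) from funext fun w ↦ Real.fourierInv_eq_fourier_neg b w]
    exact this.comp continuous_neg
  have hle (w : ℝ) : (1 + w ^ 2) * ‖𝓕⁻ b w‖ ≤ M * (1 + w ^ 2)⁻¹ := by
    have h := hM (-w)
    rw [← Real.fourierInv_eq_fourier_neg, neg_sq] at h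
    rw [← div_eq_mul_inv, le_div_iff₀ (by positivity)]
    linarith
  have hdom := integrable_inv_one_add_sq.const_mul M
  refine ⟨hdom.mono' hcont.aestronglyMeasurable (ae_of_all _ fun w ↦ ?_),
    hdom.mono' (by fun_prop) (ae_of_all _ fun w ↦ ?_)⟩
  · nlinarith [hle w, mul_nonneg (sq_nonneg w) (norm_nonneg (𝓕⁻ b w))]
  · rw [Real.norm_of_nonneg (by positivity)]
    nlinarith [hle w, norm_nonneg (𝓕⁻ b w)]

theorem norm_integral_gaussian_mul_sub_le {b : ℝ → ℂ} (hb : ContDiff ℝ 4 b)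
    (hs : HasCompactSupport b) {c : ℂ} (hc : 0 < c.re) :
    ‖(∫ s : ℝ, cexp (-Real.pi * c * s ^ 2) * b s) - 1 / c ^ (1 / 2 : ℂ) * b 0‖
      ≤ ‖1 / c ^ (1 / 2 : ℂ)‖ * (Real.pi / ‖c‖ * ∫ w : ℝ, w ^ 2 * ‖𝓕⁻ b w‖) := by
  obtain ⟨hB, hB2⟩ := integrable_fourierInv hb hs
  have hbi : Integrable b := hb.continuous.integrable_of_hasCompactSupport hs
  have hinv : 𝓕 (𝓕⁻ b) = b := by
    refine hb.continuous.fourier_fourierInv_eq hbi ?_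
    have h := hB.comp_neg
    simpa [Real.fourierInv_eq_fourier_neg] using h
  have hG : Integrable (fun s : ℝ ↦ cexp (-Real.pi * c * s ^ 2)) := by
    have := integrable_cexp_neg_mul_sq (b := Real.pi * c)
      (by rw [re_ofReal_mul]; exact mul_pos Real.pi_pos hc)
    simpa using this
  have hflip : ∫ s : ℝ, 𝓕 (fun s : ℝ ↦ cexp (-Real.pi * c * s ^ 2)) s • 𝓕⁻ b s
      = ∫ s : ℝ, cexp (-Real.pi * c * s ^ 2) • 𝓕 (𝓕⁻ b) s := by
    simpa using! VectorFourier.integral_fourierIntegral_smul_eq_flip (L := innerₗ ℝ)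
      Real.continuous_fourierChar continuous_inner hG hB
  have hb0 : b 0 = ∫ w : ℝ, 𝓕⁻ b w := by
    conv_lhs => rw [← hinv]
    simp [Real.fourier_real_eq]
  have hre (w : ℝ) : 0 ≤ (Real.pi / c * w ^ 2 : ℂ).re := by
    have : (Real.pi / c * w ^ 2 : ℂ) = ((Real.pi * w ^ 2 : ℝ) : ℂ) * c⁻¹ := by
      push_cast; ring
    rw [this, re_ofReal_mul, inv_re]
    have := normSq_nonneg c
    positivity
  have hexp (w : ℝ) : cexp (-Real.pi / c * w ^ 2) = cexp (-(Real.pi / c * w ^ 2)) := by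
    congr 1; ring
  have hint : Integrable (fun w : ℝ ↦ cexp (-Real.pi / c * w ^ 2) * 𝓕⁻ b w) := by
    refine hB.bdd_mul (c := 1) (by fun_prop) (ae_of_all _ fun w ↦ ?_)
    rw [hexp, Complex.norm_exp, neg_re]
    simpa using hre w
  rw [hinv, fourier_gaussian_pi hc] at hflip
  simp only [smul_eq_mul, mul_assoc] at hflip
  simp only [mul_assoc]
  rw [← hflip, integral_const_mul, hb0, ← mul_sub, norm_mul, ← integral_sub hint hB,
    ← integral_const_mul]
  gcongr
  refine norm_integral_le_of_norm_le (hB2.const_mul _) (ae_of_all _ fun w ↦ ?_)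
  rw [← sub_one_mul, norm_mul, hexp, ← mul_assoc]
  gcongr
  refine (norm_exp_neg_sub_one_le (hre w)).trans_eq ?_
  simp [abs_of_pos Real.pi_pos]

theorem norm_integral_gaussian_mul_sub_le_of_re_nonneg {b : ℝ → ℂ} (hb : ContDiff ℝ 4 b)
    (hs : HasCompactSupport b) {c : ℂ} (hc : 0 ≤ c.re) (hc0 : c ≠ 0) :
    ‖(∫ s : ℝ, cexp (-Real.pi * c * s ^ 2) * b s) - 1 / c ^ (1 / 2 : ℂ) * b 0‖
      ≤ ‖1 / c ^ (1 / 2 : ℂ)‖ * (Real.pi / ‖c‖ * ∫ w : ℝ, w ^ 2 * ‖𝓕⁻ b w‖) := by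
  have hslit : c ∈ slitPlane := by
    rw [mem_slitPlane_iff]
    by_contra! h
    exact hc0 (Complex.ext (le_antisymm h.1 hc) h.2)
  have hlim : Tendsto (fun ε : ℝ ↦ c + ε) (𝓝[>] 0) (𝓝 c) := by
    have : Continuous (fun ε : ℝ ↦ c + ε) := by fun_prop
    simpa using (this.tendsto 0).mono_left nhdsWithin_le_nhds
  have hpow : Tendsto (fun ε : ℝ ↦ 1 / (c + ε) ^ (1 / 2 : ℂ)) (𝓝[>] 0)
      (𝓝 (1 / c ^ (1 / 2 : ℂ))) :=
    tendsto_const_nhds.div (((continuousAt_cpow_const hslit).tendsto).comp hlim)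
      (by simp [cpow_eq_zero_iff, hc0])
  have hint : Tendsto (fun ε : ℝ ↦ ∫ s : ℝ, cexp (-Real.pi * (c + ε) * s ^ 2) * b s) (𝓝[>] 0)
      (𝓝 (∫ s : ℝ, cexp (-Real.pi * c * s ^ 2) * b s)) := by
    have hbc := hb.continuous
    refine tendsto_integral_filter_of_dominated_convergence (fun s ↦ ‖b s‖)
      (Eventually.of_forall fun ε ↦ by fun_prop) ?_
      (hbc.integrable_of_hasCompactSupport hs).norm (ae_of_all _ fun s ↦ ?_)
    · filter_upwards [self_mem_nhdsWithin] with ε (hε : 0 < ε)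
      refine ae_of_all _ fun s ↦ ?_
      rw [norm_mul]
      refine mul_le_of_le_one_left (norm_nonneg _) ?_
      rw [Complex.norm_exp, Real.exp_le_one_iff]
      have : (-Real.pi * (c + ε) * s ^ 2 : ℂ) = ((-(Real.pi * s ^ 2) : ℝ) : ℂ) * (c + ε) := by
        push_cast; ring
      rw [this, re_ofReal_mul, add_re, ofReal_re, neg_mul, neg_nonpos]
      positivity
    · have hcont : Continuous (fun z : ℂ ↦ cexp (-Real.pi * z * s ^ 2) * b s) := by fun_prop
      exact (hcont.tendsto c).comp hlim
  refine le_of_tendsto_of_tendsto (hint.sub (hpow.mul_const _)).norm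
    (hpow.norm.mul ((tendsto_const_nhds.div hlim.norm (norm_ne_zero_iff.2 hc0)).mul_const _)) ?_
  filter_upwards [self_mem_nhdsWithin] with ε (hε : 0 < ε)
  exact norm_integral_gaussian_mul_sub_le hb hs (by rw [add_re, ofReal_re]; positivity)

/-- Stationary phase for the quadratic phase `s² / 2`. -/
theorem exists_norm_integral_quadratic_phase_sub_le {b : ℝ → ℂ} (hb : ContDiff ℝ 4 b)
    (hs : HasCompactSupport b) :
    ∃ C : ℝ, ∀ t : ℝ, 0 < t →
      ‖(∫ s : ℝ, cexp (I * t * (s ^ 2 / 2)) * b s)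
          - (Real.sqrt (2 * Real.pi / t) : ℂ) * cexp (I * Real.pi / 4) * b 0‖
        ≤ C * t ^ (-(3 : ℝ) / 2) := by
  refine ⟨Real.sqrt (2 * Real.pi) * (2 * Real.pi ^ 2 * ∫ w : ℝ, w ^ 2 * ‖𝓕⁻ b w‖),
    fun t ht ↦ ?_⟩
  have hpi := Real.pi_pos
  set c : ℂ := ((t / (2 * Real.pi) : ℝ) : ℂ) * -I with hc
  set X : ℂ := (Real.sqrt (t / (2 * Real.pi)) : ℂ) * cexp (-(I * Real.pi / 4)) with hX
  have hXsq : X ^ 2 = c := by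
    rw [hX, mul_pow, ← ofReal_pow, Real.sq_sqrt (by positivity), ← Complex.exp_nat_mul, hc]
    congr 1
    rw [← exp_neg_pi_div_two_mul_I]
    congr 1
    push_cast; ring
  have hXre : 0 < X.re := by
    have : (-(I * Real.pi / 4) : ℂ) = ((-(Real.pi / 4) : ℝ) : ℂ) * I := by push_cast; ring
    rw [hX, re_ofReal_mul, this, exp_ofReal_mul_I_re, Real.cos_neg, Real.cos_pi_div_four]
    positivity
  have hcX : 1 / c ^ (1 / 2 : ℂ) = (Real.sqrt (2 * Real.pi / t) : ℂ) * cexp (I * Real.pi / 4) := by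
    rw [← hXsq, one_div 2, Complex.sq_cpow_two_inv hXre, hX, one_div, mul_inv,
      ← Complex.exp_neg, neg_neg, ← ofReal_inv, ← Real.sqrt_inv, inv_div]
  have hnormc : ‖c‖ = t / (2 * Real.pi) := by
    rw [hc, norm_mul, norm_neg, norm_I, mul_one, Complex.norm_of_nonneg (by positivity)]
  have hc0 : c ≠ 0 := by
    rw [← norm_ne_zero_iff, hnormc]; positivity
  have h := norm_integral_gaussian_mul_sub_le_of_re_nonneg hb hs (c := c)
    (by rw [hc, re_ofReal_mul]; simp) hc0
  rw [hcX, hnormc] at h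
  have hphase (s : ℝ) : cexp (-Real.pi * c * s ^ 2) = cexp (I * t * (s ^ 2 / 2)) := by
    congr 1
    rw [hc]
    push_cast
    have : (Real.pi : ℂ) ≠ 0 := ofReal_ne_zero.2 hpi.ne'
    field_simp
  simp only [hphase] at h
  refine h.trans_eq ?_
  have hexp : ‖cexp (I * Real.pi / 4)‖ = 1 := by
    rw [show (I * Real.pi / 4 : ℂ) = ((Real.pi / 4 : ℝ) : ℂ) * I by push_cast; ring]
    exact norm_exp_ofReal_mul_I _
  have hpow : t ^ (-(3 : ℝ) / 2) = (Real.sqrt t)⁻¹ * t⁻¹ := by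
    rw [Real.sqrt_eq_rpow, ← Real.rpow_neg ht.le, ← Real.rpow_neg_one t, ← Real.rpow_add ht]
    norm_num
  rw [norm_mul, hexp, Complex.norm_of_nonneg (Real.sqrt_nonneg _), hpow,
    Real.sqrt_div (by positivity)]
  field_simp

/-- The change of variables with `√(1 + (kgVar s)²) = 1 + s² / 2`. -/
noncomputable def kgVar (s : ℝ) : ℝ := s * Real.sqrt (1 + s ^ 2 / 4)

noncomputable def kgJac (s : ℝ) : ℝ := (1 + s ^ 2 / 2) / Real.sqrt (1 + s ^ 2 / 4)

theorem sqrt_one_add_kgVar_sq (s : ℝ) : Real.sqrt (1 + kgVar s ^ 2) = 1 + s ^ 2 / 2 := by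
  rw [kgVar, mul_pow, Real.sq_sqrt (by positivity),
    show 1 + s ^ 2 * (1 + s ^ 2 / 4) = (1 + s ^ 2 / 2) ^ 2 by ring, Real.sqrt_sq (by positivity)]

theorem contDiff_sqrt_one_add_sq_div_four {n : WithTop ℕ∞} :
    ContDiff ℝ n (fun s : ℝ ↦ Real.sqrt (1 + s ^ 2 / 4)) :=
  ContDiff.sqrt (by fun_prop) fun s ↦ by positivity

theorem contDiff_kgVar {n : WithTop ℕ∞} : ContDiff ℝ n kgVar :=
  contDiff_id.mul contDiff_sqrt_one_add_sq_div_four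

theorem contDiff_kgJac {n : WithTop ℕ∞} : ContDiff ℝ n kgJac :=
  ContDiff.div (by fun_prop) contDiff_sqrt_one_add_sq_div_four fun s ↦ by positivity

theorem kgJac_pos (s : ℝ) : 0 < kgJac s := by
  unfold kgJac; positivity

theorem hasDerivAt_kgVar (s : ℝ) : HasDerivAt kgVar (kgJac s) s := by
  have h1 : HasDerivAt (fun s : ℝ ↦ 1 + s ^ 2 / 4) (s / 2) s := by
    convert! (((hasDerivAt_id s).pow 2).div_const 4).const_add 1 using 1
    simp; ring
  have hpos : 0 < 1 + s ^ 2 / 4 := by positivity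
  convert! (hasDerivAt_id s).mul (h1.sqrt hpos.ne') using 1
  have hsqrt := (Real.sqrt_pos.2 hpos).ne'
  rw [kgJac, div_eq_iff hsqrt]
  simp only [id, one_mul, add_mul]
  rw [Real.mul_self_sqrt hpos.le, mul_assoc, div_mul_eq_mul_div, mul_div_mul_right _ _ hsqrt]
  ring

theorem injective_kgVar : Function.Injective kgVar :=
  (strictMono_of_deriv_pos fun s ↦ by
    rw [(hasDerivAt_kgVar s).deriv]; exact kgJac_pos s).injective

theorem surjective_kgVar : Function.Surjective kgVar := by
  intro ξ
  set J := Real.sqrt (1 + ξ ^ 2) with hJ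
  have hJ0 : 0 ≤ J := Real.sqrt_nonneg _
  have hJsq : J ^ 2 = 1 + ξ ^ 2 := Real.sq_sqrt (by positivity)
  refine ⟨ξ * Real.sqrt (2 / (J + 1)), ?_⟩
  have h : 1 + (ξ * Real.sqrt (2 / (J + 1))) ^ 2 / 4 = (2 / (J + 1))⁻¹ := by
    rw [mul_pow, Real.sq_sqrt (by positivity)]
    field_simp
    linarith
  rw [kgVar, h, Real.sqrt_inv, mul_assoc, mul_inv_cancel₀ (by positivity), mul_one]

theorem abs_le_abs_kgVar (s : ℝ) : |s| ≤ |kgVar s| := by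
  rw [kgVar, abs_mul, abs_of_nonneg (Real.sqrt_nonneg _)]
  exact le_mul_of_one_le_right (abs_nonneg s) (Real.one_le_sqrt.2 (by nlinarith [sq_nonneg s]))

theorem tendsto_kgVar_cocompact : Tendsto kgVar (cocompact ℝ) (cocompact ℝ) := by
  refine tendsto_cocompact_of_tendsto_dist_comp_atTop 0 ?_
  refine tendsto_atTop_mono (f := fun s : ℝ ↦ ‖s‖) (fun s ↦ ?_) tendsto_norm_cocompact_atTop
  simpa using abs_le_abs_kgVar s

theorem integral_comp_kgVar (g : ℝ → ℂ) :
    ∫ ξ : ℝ, g ξ = ∫ s : ℝ, (kgJac s : ℂ) * g (kgVar s) := by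
  have h := integral_image_eq_integral_abs_deriv_smul MeasurableSet.univ
    (fun s _ ↦ (hasDerivAt_kgVar s).hasDerivWithinAt) injective_kgVar.injOn g
  rw [Set.image_univ, surjective_kgVar.range_eq] at h
  simpa [abs_of_pos (kgJac_pos _)] using h

end StationaryPhase

open StationaryPhase in
/-- Stationary phase for the Klein–Gordon phase `⟨ξ⟩ = √(1+ξ²)`: for `a : ℝ → ℂ` of
class `C⁴` with compact support, there is a constant `C` such that for `t ≥ 1`,
`|∫ e^{it√(1+ξ²)} a(ξ) dξ − √(2π/t) e^{iπ/4} e^{it} a(0)| ≤ C t^{−3/2}`. -/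
theorem stationary_phase_kleinGordon
    (a : ℝ → ℂ) (ha : ContDiff ℝ 4 a) (hsupp : HasCompactSupport a) :
    ∃ C : ℝ, ∀ t : ℝ, 1 ≤ t →
      ‖(∫ ξ : ℝ, Complex.exp (Complex.I * t * Real.sqrt (1 + ξ ^ 2)) * a ξ)
          - (Real.sqrt (2 * Real.pi / t) : ℂ) * Complex.exp (Complex.I * Real.pi / 4) *
            Complex.exp (Complex.I * t) * a 0‖
        ≤ C * t ^ (-(3 : ℝ) / 2) := by
  have hb : ContDiff ℝ 4 (fun s ↦ (kgJac s : ℂ) * a (kgVar s)) :=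
    (Complex.ofRealCLM.contDiff.comp contDiff_kgJac).mul (ha.comp contDiff_kgVar)
  have hbs : HasCompactSupport (fun s ↦ (kgJac s : ℂ) * a (kgVar s)) := by
    refine HasCompactSupport.mul_left (f := fun s ↦ (kgJac s : ℂ)) ?_
    rw [hasCompactSupport_iff_eventuallyEq, Filter.coclosedCompact_eq_cocompact] at hsupp ⊢
    exact hsupp.comp_tendsto tendsto_kgVar_cocompact
  obtain ⟨C, hC⟩ := exists_norm_integral_quadratic_phase_sub_le hb hbs
  refine ⟨C, fun t ht ↦ le_of_eq_of_le ?_ (hC t (by linarith))⟩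
  have hint : ∫ ξ : ℝ, Complex.exp (Complex.I * t * Real.sqrt (1 + ξ ^ 2)) * a ξ =
      Complex.exp (Complex.I * t) *
        ∫ s : ℝ, Complex.exp (Complex.I * t * (s ^ 2 / 2)) * ((kgJac s : ℂ) * a (kgVar s)) := by
    rw [integral_comp_kgVar, ← integral_const_mul]
    congr 1 with s
    rw [sqrt_one_add_kgVar_sq, show Complex.I * t * ((1 + s ^ 2 / 2 : ℝ) : ℂ) =
      Complex.I * t + Complex.I * t * (s ^ 2 / 2) by push_cast; ring, Complex.exp_add]
    ring
  have h0 : (kgJac 0 : ℂ) * a (kgVar 0) = a 0 := by simp [kgJac, kgVar]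
  have hexp : ‖Complex.exp (Complex.I * t)‖ = 1 := by
    rw [mul_comm]; exact Complex.norm_exp_ofReal_mul_I t
  rw [hint, h0, mul_right_comm _ _ (a 0), mul_comm _ (Complex.exp (Complex.I * t)), ← mul_sub,
    norm_mul, hexp, one_mul]
end

section
/- Fix constants 0 < c₁ < c₂. There exists a constant C, depending only on c₁ and c₂, with the following property: for all λ ≥ 1, all t ≥ λ, all v ∈ ℝ, and every twice continuously differentiable function ω : ℝ → ℂ supported in the interval [c₁λ, c₂λ] and satisfying |ω(ξ)| ≤ 1, |ω'(ξ)| ≤ λ^{−1}, |ω''(ξ)| ≤ λ^{−2} for all ξ, one has |∫_0^∞ e^{it(√(1+ξ²) + vξ)} ω(ξ) dξ| ≤ C λ^{3/2} t^{−1/2}. -/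
open MeasureTheory

/-- Derivative of the regularised reciprocal `u / (u² + s²)` of `u`. -/
lemma HasDerivAt.div_sq_add_sq {u : ℝ → ℝ} {u' x s : ℝ} (hs : 0 < s) (hu : HasDerivAt u u' x) :
    HasDerivAt (fun y => u y / (u y ^ 2 + s ^ 2))
      (u' * (s ^ 2 - u x ^ 2) / (u x ^ 2 + s ^ 2) ^ 2) x := by
  have hne : u x ^ 2 + s ^ 2 ≠ 0 := by positivity
  refine (hu.fun_div ((hu.fun_pow 2).add_const (s ^ 2)) hne).congr_deriv ?_
  norm_num
  ring

/-- Derivative of `arctan (u / s) / s`. -/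
lemma HasDerivAt.arctan_div_div {u : ℝ → ℝ} {u' x s : ℝ} (hs : 0 < s) (hu : HasDerivAt u u' x) :
    HasDerivAt (fun y => Real.arctan (u y / s) / s) (u' / (u x ^ 2 + s ^ 2)) x := by
  have hne : u x ^ 2 + s ^ 2 ≠ 0 := by positivity
  have hne' : 1 + (u x / s) ^ 2 ≠ 0 := by positivity
  refine ((hu.div_const s).arctan.div_const s).congr_deriv ?_
  field_simp
  ring

/-- Van der Corput's second-derivative estimate with a compactly supported amplitude. -/
lemma norm_integral_exp_mul_le_of_sq_le_second_deriv
    {a b s L : ℝ} (hab : a ≤ b) (hs : 0 < s) {φ u w : ℝ → ℝ} {ω ω' : ℝ → ℂ}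
    (hφ : ∀ x, HasDerivAt φ (u x) x) (hu : ∀ x, HasDerivAt u (w x) x) (hw : Continuous w)
    (hsw : ∀ x ∈ Set.Icc a b, s ^ 2 ≤ w x)
    (hω : ∀ x, HasDerivAt ω (ω' x) x) (hω' : Continuous ω')
    (ha : ω a = 0) (hb : ω b = 0) (h0 : ∀ x, ‖ω x‖ ≤ 1) (h1 : ∀ x, ‖ω' x‖ ≤ L) :
    ‖∫ x in a..b, Complex.exp (Complex.I * φ x) * ω x‖ ≤
      (2 * Real.pi + L * (b - a) / 2) / s := by
  have hφc : Continuous φ := continuous_iff_continuousAt.2 fun x => (hφ x).continuousAt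
  have huc : Continuous u := continuous_iff_continuousAt.2 fun x => (hu x).continuousAt
  have hωc : Continuous ω := continuous_iff_continuousAt.2 fun x => (hω x).continuousAt
  have hpos : ∀ x, 0 < u x ^ 2 + s ^ 2 := fun x => by positivity
  have hne : ∀ x, u x ^ 2 + s ^ 2 ≠ 0 := fun x => (hpos x).ne'
  set h : ℝ → ℝ := fun y => u y / (u y ^ 2 + s ^ 2) with hh
  set h' : ℝ → ℝ := fun x => w x * (s ^ 2 - u x ^ 2) / (u x ^ 2 + s ^ 2) ^ 2 with hh'
  have hhd : ∀ x, HasDerivAt h (h' x) x := fun x => (hu x).div_sq_add_sq hs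
  have hhc : Continuous h := huc.div (by fun_prop) hne
  have hhc' : Continuous h' :=
    (by fun_prop : Continuous fun x => w x * (s ^ 2 - u x ^ 2)).div (by fun_prop)
      fun x => pow_ne_zero 2 (hne x)
  set e : ℝ → ℂ := fun x => Complex.exp (Complex.I * φ x) with he
  have hec : Continuous e := by fun_prop
  have hed : ∀ x, HasDerivAt e (e x * (Complex.I * u x)) x := fun x =>
    (((hφ x).ofReal_comp).const_mul Complex.I).cexp
  have hen : ∀ x, ‖e x‖ = 1 := fun x => by
    rw [he]
    simp only [mul_comm Complex.I]
    exact Complex.norm_exp_ofReal_mul_I _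
  set G' : ℝ → ℂ := fun x =>
    (e x * (Complex.I * u x) * ω x + e x * ω' x) * h x + e x * ω x * h' x with hG'
  have hGd : ∀ x, HasDerivAt (fun y => e y * ω y * h y) (G' x) x := fun x =>
    ((hed x).mul (hω x)).mul (hhd x).ofReal_comp
  have hGc : Continuous G' := by fun_prop
  have hG : ∫ x in a..b, G' x = 0 := by
    rw [intervalIntegral.integral_eq_sub_of_hasDerivAt (fun x _ => hGd x)
      (hGc.intervalIntegrable _ _)]
    simp [ha, hb]
  have hwc : Continuous fun x => w x / (u x ^ 2 + s ^ 2) := hw.div (by fun_prop) hne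
  have hA : ∫ x in a..b, w x / (u x ^ 2 + s ^ 2) ≤ Real.pi / s := by
    rw [intervalIntegral.integral_eq_sub_of_hasDerivAt
      (fun x _ => (hu x).arctan_div_div hs) (hwc.intervalIntegrable _ _), ← sub_div]
    gcongr
    linarith [Real.arctan_lt_pi_div_two (u b / s), Real.neg_pi_div_two_lt_arctan (u a / s)]
  have hh_le : ∀ x, |h x| ≤ 1 / (2 * s) := fun x => by
    rw [hh]
    simp only [abs_div, abs_of_pos (hpos x)]
    rw [div_le_div_iff₀ (hpos x) (by positivity)]
    nlinarith [sq_nonneg (|u x| - s), sq_abs (u x)]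
  have hh'_le : ∀ x ∈ Set.Icc a b, |h' x| ≤ w x / (u x ^ 2 + s ^ 2) := fun x hx => by
    have hwx : 0 ≤ w x := (sq_nonneg s).trans (hsw x hx)
    have habs : |s ^ 2 - u x ^ 2| ≤ u x ^ 2 + s ^ 2 := by
      rw [abs_le]
      constructor <;> nlinarith [sq_nonneg s, sq_nonneg (u x)]
    rw [hh']
    simp only [abs_div, abs_mul, abs_of_nonneg hwx, abs_of_pos (pow_pos (hpos x) 2)]
    rw [div_le_div_iff₀ (pow_pos (hpos x) 2) (hpos x)]
    nlinarith [mul_le_mul_of_nonneg_left habs (mul_nonneg hwx (hpos x).le)]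
  have hid : ∀ x, e x * ω x + Complex.I * G' x =
      e x * ω x * ((s ^ 2 / (u x ^ 2 + s ^ 2) : ℝ) : ℂ) +
        Complex.I * (e x * ω' x * h x + e x * ω x * h' x) := fun x => by
    have h2 : (u x : ℂ) * (h x : ℂ) = 1 - ((s ^ 2 / (u x ^ 2 + s ^ 2) : ℝ) : ℂ) := by
      have : u x * h x = 1 - s ^ 2 / (u x ^ 2 + s ^ 2) := by
        rw [hh]
        field_simp [hne x]
        ring
      exact_mod_cast this
    rw [hG']
    linear_combination (e x * ω x * (u x * h x)) * Complex.I_sq - e x * ω x * h2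
  have hbound : ∀ x ∈ Set.Icc a b, ‖e x * ω x + Complex.I * G' x‖ ≤
      2 * (w x / (u x ^ 2 + s ^ 2)) + L * (1 / (2 * s)) := fun x hx => by
    have hL : 0 ≤ L := (norm_nonneg _).trans (h1 x)
    have n1 : ‖e x * ω x * ((s ^ 2 / (u x ^ 2 + s ^ 2) : ℝ) : ℂ)‖ ≤
        w x / (u x ^ 2 + s ^ 2) := by
      rw [norm_mul, norm_mul, hen, one_mul, Complex.norm_real, Real.norm_of_nonneg (by positivity)]
      calc ‖ω x‖ * (s ^ 2 / (u x ^ 2 + s ^ 2)) ≤ 1 * (w x / (u x ^ 2 + s ^ 2)) := by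
            gcongr
            · exact h0 x
            · exact hsw x hx
        _ = _ := one_mul _
    have n2 : ‖e x * ω' x * h x‖ ≤ L * (1 / (2 * s)) := by
      rw [norm_mul, norm_mul, hen, one_mul, Complex.norm_real, Real.norm_eq_abs]
      exact mul_le_mul (h1 x) (hh_le x) (abs_nonneg _) hL
    have n3 : ‖e x * ω x * h' x‖ ≤ w x / (u x ^ 2 + s ^ 2) := by
      rw [norm_mul, norm_mul, hen, one_mul, Complex.norm_real, Real.norm_eq_abs]
      exact (mul_le_of_le_one_left (abs_nonneg _) (h0 x)).trans (hh'_le x hx)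
    rw [hid]
    refine (norm_add_le _ _).trans ?_
    rw [norm_mul Complex.I, Complex.norm_I, one_mul]
    linarith [norm_add_le (e x * ω' x * h x) (e x * ω x * h' x)]
  have hsplit : ∫ x in a..b, e x * ω x = ∫ x in a..b, (e x * ω x + Complex.I * G' x) := by
    rw [intervalIntegral.integral_add
      (Continuous.intervalIntegrable (by fun_prop) _ _)
      (Continuous.intervalIntegrable (by fun_prop) _ _),
      intervalIntegral.integral_const_mul, hG, mul_zero, add_zero]
  have hBc : Continuous fun x => 2 * (w x / (u x ^ 2 + s ^ 2)) := continuous_const.mul hwc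
  rw [hsplit]
  refine (intervalIntegral.norm_integral_le_of_norm_le hab
    (Filter.Eventually.of_forall fun x hx => hbound x (Set.Ioc_subset_Icc_self hx))
    ((hBc.add continuous_const).intervalIntegrable _ _)).trans ?_
  rw [intervalIntegral.integral_add (hBc.intervalIntegrable _ _)
    (continuous_const.intervalIntegrable _ _), intervalIntegral.integral_const_mul,
    intervalIntegral.integral_const, smul_eq_mul]
  calc _ ≤ 2 * (Real.pi / s) + (b - a) * (L * (1 / (2 * s))) := by gcongr
    _ = _ := by field_simp

/-- The first derivative of the Japanese bracket. -/
lemma hasDerivAt_sqrt_one_add_sq (x : ℝ) :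
    HasDerivAt (fun y : ℝ => Real.sqrt (1 + y ^ 2)) (x / Real.sqrt (1 + x ^ 2)) x := by
  have hpos : 0 < 1 + x ^ 2 := by positivity
  refine ((((hasDerivAt_id' x).fun_pow 2).const_add 1).sqrt hpos.ne').congr_deriv ?_
  norm_num
  field_simp

/-- The second derivative of the Japanese bracket. -/
lemma hasDerivAt_div_sqrt_one_add_sq (x : ℝ) :
    HasDerivAt (fun y : ℝ => y / Real.sqrt (1 + y ^ 2)) (1 / Real.sqrt (1 + x ^ 2) ^ 3) x := by
  have hpos : 0 < 1 + x ^ 2 := by positivity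
  have hr : 0 < Real.sqrt (1 + x ^ 2) := Real.sqrt_pos.2 hpos
  have hsq : Real.sqrt (1 + x ^ 2) ^ 2 = 1 + x ^ 2 := Real.sq_sqrt hpos.le
  refine ((hasDerivAt_id' x).fun_div (hasDerivAt_sqrt_one_add_sq x) hr.ne').congr_deriv ?_
  field_simp
  linarith

/-- Dyadic oscillatory-integral bound for the Klein–Gordon phase: for symbols `ω`
supported in `[c₁λ, c₂λ]` with `|ω| ≤ 1`, `|ω'| ≤ λ⁻¹`, `|ω''| ≤ λ⁻²`, and `t ≥ λ ≥ 1`,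
`|∫_0^∞ e^{it(√(1+ξ²) + vξ)} ω(ξ) dξ| ≤ C λ^{3/2} t^{−1/2}`. -/
theorem dyadic_oscillatory_bound_kleinGordon
    (c₁ c₂ : ℝ) (hc₁ : 0 < c₁) (hc : c₁ < c₂) :
    ∃ C : ℝ, ∀ lam t : ℝ, 1 ≤ lam → lam ≤ t → ∀ v : ℝ, ∀ ω : ℝ → ℂ,
      ContDiff ℝ 2 ω →
      (∀ ξ : ℝ, ξ ∉ Set.Icc (c₁ * lam) (c₂ * lam) → ω ξ = 0) →
      (∀ ξ : ℝ, ‖ω ξ‖ ≤ 1) →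
      (∀ ξ : ℝ, ‖deriv ω ξ‖ ≤ lam⁻¹) →
      (∀ ξ : ℝ, ‖deriv (deriv ω) ξ‖ ≤ lam⁻¹ ^ 2) →
      ‖∫ ξ in Set.Ioi (0 : ℝ),
          Complex.exp (Complex.I * t * (Real.sqrt (1 + ξ ^ 2) + v * ξ)) * ω ξ‖
        ≤ C * lam ^ ((3 : ℝ) / 2) * t ^ (-(1 : ℝ) / 2) := by
  set q : ℝ := Real.sqrt (1 + (c₂ + 1) ^ 2) with hq
  have hq0 : 0 < q := Real.sqrt_pos.2 (by positivity)
  have hc₂ : 0 < c₂ := hc₁.trans hc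
  refine ⟨(2 * Real.pi + (c₂ + 1) / 2) * q ^ ((3 : ℝ) / 2), ?_⟩
  intro lam t hlam ht v ω hω hsupp h0 h1 _
  have hl : 0 < lam := by linarith
  have ht0 : 0 < t := by linarith
  have hb : 0 < (c₂ + 1) * lam := by positivity
  have hωdiff : Differentiable ℝ ω := hω.differentiable (by norm_num)
  have hωc' : Continuous (deriv ω) := hω.continuous_deriv (by norm_num)
  have hω0 : ω 0 = 0 := hsupp 0 fun hx => by nlinarith [hx.1, mul_pos hc₁ hl]
  have hωlarge : ∀ x, (c₂ + 1) * lam ≤ x → ω x = 0 := fun x hx =>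
    hsupp x fun hx' => by nlinarith [hx'.2]
  have hbracket : ∀ x ∈ Set.Icc 0 ((c₂ + 1) * lam), Real.sqrt (1 + x ^ 2) ≤ q * lam := by
    intro x hx
    refine Real.sqrt_le_iff.2 ⟨by positivity, ?_⟩
    rw [mul_pow, hq, Real.sq_sqrt (by positivity)]
    nlinarith [pow_le_pow_left₀ hx.1 hx.2 2]
  set s : ℝ := t ^ ((1 : ℝ) / 2) * (q * lam) ^ (-(3 : ℝ) / 2) with hs
  have hs0 : 0 < s := by positivity
  have hs2 : s ^ 2 = t * (1 / (q * lam) ^ 3) := by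
    rw [hs, mul_pow, ← Real.rpow_mul_natCast ht0.le, ← Real.rpow_mul_natCast (by positivity)]
    norm_num
  have key := norm_integral_exp_mul_le_of_sq_le_second_deriv (a := 0) (b := (c₂ + 1) * lam)
    (s := s) (L := lam⁻¹) (φ := fun x => t * (Real.sqrt (1 + x ^ 2) + v * x))
    (u := fun x => t * (x / Real.sqrt (1 + x ^ 2) + v))
    (w := fun x => t * (1 / Real.sqrt (1 + x ^ 2) ^ 3)) (ω := ω) (ω' := deriv ω) hb.le hs0
    (fun x => by
      simpa using ((hasDerivAt_sqrt_one_add_sq x).add ((hasDerivAt_id x).const_mul v)).const_mul t)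
    (fun x => ((hasDerivAt_div_sqrt_one_add_sq x).add_const v).const_mul t)
    (continuous_const.mul (continuous_const.div (by fun_prop) fun x => by positivity))
    (fun x hx => by
      rw [hs2]
      gcongr
      exact hbracket x hx)
    (fun x => (hωdiff x).hasDerivAt) hωc' hω0 (hωlarge _ le_rfl) h0 h1
  have hint : ∫ ξ in Set.Ioi (0 : ℝ),
      Complex.exp (Complex.I * t * (Real.sqrt (1 + ξ ^ 2) + v * ξ)) * ω ξ =
      ∫ x in (0 : ℝ)..((c₂ + 1) * lam),
        Complex.exp (Complex.I * ((t * (Real.sqrt (1 + x ^ 2) + v * x) : ℝ) : ℂ)) * ω x := by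
    rw [intervalIntegral.integral_of_le hb.le,
      setIntegral_eq_of_subset_of_forall_sdiff_eq_zero measurableSet_Ioi
        (Set.Ioc_subset_Ioi_self : Set.Ioc 0 ((c₂ + 1) * lam) ⊆ Set.Ioi 0)]
    · simp only [Complex.ofReal_mul, Complex.ofReal_add, mul_assoc]
    · intro x hx
      have : (c₂ + 1) * lam ≤ x := by
        by_contra! hlt
        exact hx.2 ⟨hx.1, hlt.le⟩
      rw [hωlarge x this, mul_zero]
  rw [hint]
  refine key.trans_eq ?_
  have hinv : s⁻¹ = q ^ ((3 : ℝ) / 2) * lam ^ ((3 : ℝ) / 2) * t ^ (-(1 : ℝ) / 2) := by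
    rw [hs, mul_inv, ← Real.rpow_neg ht0.le, ← Real.rpow_neg (by positivity),
      ← Real.mul_rpow hq0.le hl.le, mul_comm]
    norm_num
  rw [div_eq_mul_inv, hinv]
  field_simp
  ring
end

section
/- Define φ(s,t) := √((t−s)² − (3/4)t²) + 2s. There exists a constant C > 0 such that for all t ≥ 10⁶: |∫_1^{10^{-3}√t} (e^{iφ(s,t)}/s) ds − (e^{it/2}/2) · log t| ≤ C. -/
open MeasureTheory intervalIntegral

lemma norm_exp_I_mul_sub_exp_I_mul_le (a b : ℝ) :
    ‖Complex.exp (Complex.I * a) - Complex.exp (Complex.I * b)‖ ≤ |a - b| := by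
  have h : Complex.exp (Complex.I * a) - Complex.exp (Complex.I * b)
      = Complex.exp (Complex.I * b) * (Complex.exp (Complex.I * ((a - b : ℝ) : ℂ)) - 1) := by
    rw [mul_sub, ← Complex.exp_add, mul_one]
    congr 2
    push_cast
    ring
  rw [h, norm_mul, Complex.norm_exp_I_mul_ofReal, one_mul]
  exact Real.norm_exp_I_mul_ofReal_sub_one_le

/-- The phase is stationary at `s = 0`, with a quadratic error. -/
lemma abs_phase_sub_le {s t : ℝ} (hs : 0 ≤ s) (ht : 0 < t) (hst : 8 * s ≤ t) :
    |Real.sqrt ((t - s) ^ 2 - 3 / 4 * t ^ 2) + 2 * s - t / 2| ≤ 12 * s ^ 2 / t := by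
  have hnonneg : 0 ≤ (t - s) ^ 2 - 3 / 4 * t ^ 2 := by nlinarith
  set q := Real.sqrt ((t - s) ^ 2 - 3 / 4 * t ^ 2) with hq
  have hq0 : 0 ≤ q := Real.sqrt_nonneg _
  have hq2 : q ^ 2 = (t - s) ^ 2 - 3 / 4 * t ^ 2 := Real.sq_sqrt hnonneg
  have hprod : (q + 2 * s - t / 2) * (q + (t / 2 - 2 * s)) = -(3 * s ^ 2) := by
    linear_combination hq2
  have hden : t / 4 ≤ q + (t / 2 - 2 * s) := by linarith
  have habs : |q + 2 * s - t / 2| * (q + (t / 2 - 2 * s)) = 3 * s ^ 2 := by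
    rw [← abs_of_nonneg (by linarith : 0 ≤ q + (t / 2 - 2 * s)), ← abs_mul, hprod, abs_neg,
      abs_of_nonneg (by positivity)]
  rw [le_div_iff₀ ht]
  nlinarith [mul_le_mul_of_nonneg_left hden (abs_nonneg (q + 2 * s - t / 2))]

/-- Logarithmic buildup along the resonant ray: with
`φ(s, t) = √((t−s)² − (3/4)t²) + 2s`, for `t ≥ 10⁶`,
`|∫_1^{10⁻³√t} e^{iφ(s,t)}/s ds − (e^{it/2}/2) log t| ≤ C`. -/
theorem resonant_log_buildup :
    ∃ C : ℝ, 0 < C ∧ ∀ t : ℝ, (10 : ℝ) ^ 6 ≤ t →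
      ‖(∫ s in (1 : ℝ)..(Real.sqrt t / 1000),
            Complex.exp (Complex.I * (Real.sqrt ((t - s) ^ 2 - 3 / 4 * t ^ 2) + 2 * s)) / s)
          - Complex.exp (Complex.I * t / 2) / 2 * (Real.log t : ℂ)‖ ≤ C := by
  refine ⟨Real.log 1000 + 1, by positivity, fun t ht => ?_⟩
  have ht0 : 0 < t := by linarith
  have hsq : Real.sqrt t ^ 2 = t := Real.sq_sqrt ht0.le
  have hroot : 1000 ≤ Real.sqrt t := Real.le_sqrt_of_sq_le (by linarith)
  set b := Real.sqrt t / 1000 with hb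
  have hb1 : 1 ≤ b := by rw [hb]; linarith
  have hbt : 10 ^ 6 * b ^ 2 = t := by rw [hb, div_pow, hsq]; ring
  have hpos : ∀ s ∈ Set.uIcc 1 b, 0 < s := fun s hs => by
    rw [Set.uIcc_of_le hb1] at hs
    linarith [hs.1]
  have hne : ∀ s ∈ Set.uIcc 1 b, (s : ℂ) ≠ 0 := fun s hs =>
    Complex.ofReal_ne_zero.2 (hpos s hs).ne'
  have hf : IntervalIntegrable (fun s : ℝ =>
      Complex.exp (Complex.I * (Real.sqrt ((t - s) ^ 2 - 3 / 4 * t ^ 2) + 2 * s)) / s)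
      volume 1 b := by
    apply ContinuousOn.intervalIntegrable
    exact ContinuousOn.div (by fun_prop) (by fun_prop) hne
  have hg : IntervalIntegrable (fun s : ℝ => Complex.exp (Complex.I * t / 2) / s)
      volume 1 b := by
    apply ContinuousOn.intervalIntegrable
    exact ContinuousOn.div (by fun_prop) (by fun_prop) hne
  have hlog : ∫ s in (1 : ℝ)..b, Complex.exp (Complex.I * t / 2) / s
      = Complex.exp (Complex.I * t / 2) * ((Real.log t / 2 - Real.log 1000 : ℝ) : ℂ) := by
    have hval : ∫ s in (1 : ℝ)..b, s⁻¹ = Real.log t / 2 - Real.log 1000 := by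
      rw [integral_inv_of_pos one_pos (by linarith), div_one, hb,
        Real.log_div (by positivity) (by norm_num), Real.log_sqrt ht0.le]
    simp only [div_eq_mul_inv (Complex.exp _)]
    rw [intervalIntegral.integral_const_mul, ← hval, ← intervalIntegral.integral_ofReal]
    simp only [Complex.ofReal_inv]
  have hbound : ‖∫ s in (1 : ℝ)..b,
      (Complex.exp (Complex.I * (Real.sqrt ((t - s) ^ 2 - 3 / 4 * t ^ 2) + 2 * s)) / s
        - Complex.exp (Complex.I * t / 2) / s)‖ ≤ 12 * b / t * |b - 1| := by
    apply intervalIntegral.norm_integral_le_of_norm_le_const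
    intro s hs
    rw [Set.uIoc_of_le hb1] at hs
    have hs0 : 0 < s := by linarith [hs.1]
    have hsb : s ≤ b := hs.2
    have hexp := (norm_exp_I_mul_sub_exp_I_mul_le
      (Real.sqrt ((t - s) ^ 2 - 3 / 4 * t ^ 2) + 2 * s) (t / 2)).trans
      (abs_phase_sub_le hs0.le ht0 (by nlinarith))
    push_cast at hexp
    rw [← mul_div_assoc] at hexp
    rw [← sub_div, norm_div, Complex.norm_real, Real.norm_of_nonneg hs0.le, div_le_iff₀ hs0]
    refine hexp.trans ?_
    rw [div_mul_eq_mul_div]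
    exact div_le_div_of_nonneg_right (by nlinarith) ht0.le
  have hsmall : 12 * b / t * |b - 1| ≤ 1 := by
    rw [abs_of_nonneg (by linarith), div_mul_eq_mul_div, div_le_one ht0]
    nlinarith
  rw [intervalIntegral.integral_sub hf hg, hlog] at hbound
  have hnorm : ‖Complex.exp (Complex.I * t / 2)‖ = 1 := by
    have := Complex.norm_exp_I_mul_ofReal (t / 2)
    push_cast at this
    rwa [← mul_div_assoc] at this
  have hconst : ‖Complex.exp (Complex.I * t / 2) * ((Real.log 1000 : ℝ) : ℂ)‖
      = Real.log 1000 := by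
    rw [norm_mul, hnorm, one_mul, Complex.norm_real,
      Real.norm_of_nonneg (Real.log_nonneg (by norm_num))]
  have htri := norm_sub_le
    ((∫ s in (1 : ℝ)..b,
      Complex.exp (Complex.I * (Real.sqrt ((t - s) ^ 2 - 3 / 4 * t ^ 2) + 2 * s)) / s)
      - Complex.exp (Complex.I * t / 2) * ((Real.log t / 2 - Real.log 1000 : ℝ) : ℂ))
    (Complex.exp (Complex.I * t / 2) * ((Real.log 1000 : ℝ) : ℂ))
  rw [hconst] at htri
  refine le_trans (le_of_eq ?_) (htri.trans (by linarith))
  congr 1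
  push_cast
  ring
end

section
/- Define φ(s,t) := √((t−s)² − (3/4)t²) + 2s. There exist constants c ∈ (0, 1/10), C > 0, and t₀ ≥ 1 such that for all t ≥ t₀: |∫_{10^{-3}√t}^{ct} (e^{iφ(s,t)}/s) ds| ≤ C. -/
open MeasureTheory intervalIntegral

/-- First-derivative test for oscillatory integrals: integrating `g φ' e^{iφ}` by parts, with `g`
nondecreasing. -/
lemma norm_integral_mul_deriv_mul_exp_le {a b : ℝ} (hab : a ≤ b) {φ φ' g g' : ℝ → ℝ}
    (hφ : ∀ s ∈ Set.Icc a b, HasDerivAt φ (φ' s) s)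
    (hg : ∀ s ∈ Set.Icc a b, HasDerivAt g (g' s) s)
    (hφ' : ContinuousOn φ' (Set.Icc a b)) (hg' : ContinuousOn g' (Set.Icc a b))
    (hg0 : ∀ s ∈ Set.Icc a b, 0 ≤ g' s) :
    ‖∫ s in a..b, ((g s * φ' s : ℝ) : ℂ) * Complex.exp (Complex.I * φ s)‖
      ≤ 2 * |g a| + 2 * |g b| := by
  have hexp : ∀ x : ℝ, ‖Complex.exp (Complex.I * x)‖ = 1 := fun x => by
    rw [mul_comm]; exact Complex.norm_exp_ofReal_mul_I x
  have hu : Set.uIcc a b = Set.Icc a b := Set.uIcc_of_le hab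
  have hφc : ContinuousOn φ (Set.Icc a b) := fun s hs => (hφ s hs).continuousAt.continuousWithinAt
  have hgc : ContinuousOn g (Set.Icc a b) := fun s hs => (hg s hs).continuousAt.continuousWithinAt
  have hec : ContinuousOn (fun s => Complex.exp (Complex.I * φ s)) (Set.Icc a b) := by
    fun_prop
  have hI1 : IntervalIntegrable
      (fun s => ((g s * φ' s : ℝ) : ℂ) * Complex.exp (Complex.I * φ s)) volume a b := by
    apply ContinuousOn.intervalIntegrable
    rw [hu]
    exact (Complex.continuous_ofReal.comp_continuousOn (hgc.mul hφ')).mul hec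
  have hI2 : IntervalIntegrable
      (fun s => -Complex.I * (g' s : ℂ) * Complex.exp (Complex.I * φ s)) volume a b := by
    apply ContinuousOn.intervalIntegrable
    rw [hu]
    exact (continuousOn_const.mul (Complex.continuous_ofReal.comp_continuousOn hg')).mul hec
  have hI3 : IntervalIntegrable g' volume a b := by
    apply ContinuousOn.intervalIntegrable
    rwa [hu]
  have hF : ∀ s ∈ Set.uIcc a b,
      HasDerivAt (fun s => -Complex.I * (g s : ℂ) * Complex.exp (Complex.I * φ s))
        (((g s * φ' s : ℝ) : ℂ) * Complex.exp (Complex.I * φ s)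
          + -Complex.I * (g' s : ℂ) * Complex.exp (Complex.I * φ s)) s := by
    intro s hs
    rw [hu] at hs
    have h1 := ((hg s hs).ofReal_comp.const_mul (-Complex.I)).mul
      ((hφ s hs).ofReal_comp.const_mul Complex.I).cexp
    refine h1.congr_deriv ?_
    push_cast
    linear_combination (-(g s : ℂ) * φ' s * Complex.exp (Complex.I * φ s)) * Complex.I_sq
  have hFTC := integral_eq_sub_of_hasDerivAt hF (hI1.add hI2)
  rw [integral_add hI1 hI2] at hFTC
  have h2 : ‖∫ s in a..b, -Complex.I * (g' s : ℂ) * Complex.exp (Complex.I * φ s)‖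
      ≤ g b - g a := by
    rw [← integral_eq_sub_of_hasDerivAt (fun s hs => hg s (hu ▸ hs)) hI3]
    refine norm_integral_le_of_norm_le hab (Filter.Eventually.of_forall fun s hs => ?_) hI3
    have := hg0 s (Set.Ioc_subset_Icc_self hs)
    simp [hexp, abs_of_nonneg this]
  have hn : ∀ s, ‖-Complex.I * (g s : ℂ) * Complex.exp (Complex.I * φ s)‖ = |g s| := by
    intro s
    simp [hexp]
  rw [eq_sub_of_add_eq hFTC]
  refine (norm_sub_le _ _).trans ?_
  have h3 := norm_sub_le (-Complex.I * (g b : ℂ) * Complex.exp (Complex.I * φ b))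
    (-Complex.I * (g a : ℂ) * Complex.exp (Complex.I * φ a))
  rw [hn, hn] at h3
  linarith [le_abs_self (g b), neg_abs_le (g a)]

/-- Boundedness of the non-stationary part of the resonant integral: with
`φ(s, t) = √((t−s)² − (3/4)t²) + 2s`, there exist `c ∈ (0, 1/10)`, `C > 0` and `t₀ ≥ 1`
such that for all `t ≥ t₀`, `|∫_{10⁻³√t}^{ct} e^{iφ(s,t)}/s ds| ≤ C`. -/
theorem resonant_tail_bounded :
    ∃ c : ℝ, c ∈ Set.Ioo (0 : ℝ) (1 / 10) ∧ ∃ C : ℝ, 0 < C ∧ ∃ t₀ : ℝ, 1 ≤ t₀ ∧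
      ∀ t : ℝ, t₀ ≤ t →
        ‖∫ s in (Real.sqrt t / 1000)..(c * t),
            Complex.exp (Complex.I * (Real.sqrt ((t - s) ^ 2 - 3 / 4 * t ^ 2) + 2 * s)) / s‖
          ≤ C := by
  refine ⟨1 / 20, by norm_num, 2000000, by norm_num, 1, le_rfl, fun t ht => ?_⟩
  have ht0 : 0 < t := by linarith
  have hsq : Real.sqrt t ^ 2 = t := Real.sq_sqrt ht0.le
  have hsq1 : 1 ≤ Real.sqrt t := Real.one_le_sqrt.mpr ht
  have hab : Real.sqrt t / 1000 ≤ 1 / 20 * t := by nlinarith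
  have ha : 0 < Real.sqrt t / 1000 := by positivity
  set a := Real.sqrt t / 1000 with ha_def
  set b := 1 / 20 * t with hb_def
  have hat : a ^ 2 = t / 1000000 := by rw [ha_def, div_pow, hsq]; norm_num
  let q : ℝ → ℝ := fun s => (t - s) ^ 2 - 3 / 4 * t ^ 2
  let R : ℝ → ℝ := fun s => Real.sqrt (q s)
  let N : ℝ → ℝ := fun s => R s * (2 * R s + (t - s))
  let D : ℝ → ℝ := fun s => 3 * (s ^ 2 * (2 * t - s))
  let φ : ℝ → ℝ := fun s => R s + 2 * s
  let φ' : ℝ → ℝ := fun s => -(t - s) / R s + 2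
  let N' : ℝ → ℝ := fun s => -(4 * (t - s) + R s + (t - s) ^ 2 / R s)
  let D' : ℝ → ℝ := fun s => 3 * (4 * t * s - 3 * s ^ 2)
  let g : ℝ → ℝ := fun s => -(N s / D s)
  let g' : ℝ → ℝ := fun s => -((N' s * D s - N s * D' s) / D s ^ 2)
  have hs0 : ∀ s ∈ Set.Icc a b, 0 < s := fun s hs => ha.trans_le hs.1
  have hq : ∀ s ∈ Set.Icc a b, 0 < q s := by
    intro s hs
    have h1 := hs.2
    have h2 : 19 / 20 * t ≤ t - s := by linarith
    have h3 : (19 / 20 * t) ^ 2 ≤ (t - s) ^ 2 := by gcongr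
    change 0 < (t - s) ^ 2 - 3 / 4 * t ^ 2
    nlinarith
  have hR : ∀ s ∈ Set.Icc a b, 0 < R s := fun s hs => Real.sqrt_pos.mpr (hq s hs)
  have hR2 : ∀ s ∈ Set.Icc a b, R s ^ 2 = (t - s) ^ 2 - 3 / 4 * t ^ 2 :=
    fun s hs => Real.sq_sqrt (hq s hs).le
  have hD : ∀ s ∈ Set.Icc a b, 0 < D s := by
    intro s hs
    have h1 := hs0 s hs
    have h2 : 0 < 2 * t - s := by linarith [hs.2]
    change 0 < 3 * (s ^ 2 * (2 * t - s))
    positivity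
  have hRd : ∀ s ∈ Set.Icc a b, HasDerivAt R (-(t - s) / R s) s := by
    intro s hs
    have h1 : HasDerivAt q (-2 * (t - s)) s := by
      have := (((hasDerivAt_id s).const_sub t).pow 2).sub_const (3 / 4 * t ^ 2)
      refine this.congr_deriv ?_
      simp
    refine (h1.sqrt (hq s hs).ne').congr_deriv ?_
    have := (hR s hs).ne'
    change -2 * (t - s) / (2 * R s) = -(t - s) / R s
    field_simp
  have hφd : ∀ s ∈ Set.Icc a b, HasDerivAt φ (φ' s) s := by
    intro s hs
    have := (hRd s hs).add ((hasDerivAt_id s).const_mul 2)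
    refine this.congr_deriv ?_
    simp [φ']
  have hNd : ∀ s ∈ Set.Icc a b, HasDerivAt N (N' s) s := by
    intro s hs
    have := (hRd s hs).mul (((hRd s hs).const_mul 2).add ((hasDerivAt_id s).const_sub t))
    refine this.congr_deriv ?_
    have := (hR s hs).ne'
    simp only [N', Pi.add_apply, id]
    field_simp
    ring
  have hDd : ∀ s ∈ Set.Icc a b, HasDerivAt D (D' s) s := by
    intro s hs
    have := (((hasDerivAt_id s).pow 2).mul ((hasDerivAt_id s).const_sub (2 * t))).const_mul 3
    refine this.congr_deriv ?_
    simp [D']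
    ring
  have hgd : ∀ s ∈ Set.Icc a b, HasDerivAt g (g' s) s := fun s hs =>
    ((hNd s hs).div (hDd s hs) (hD s hs).ne').neg
  have hRc : ContinuousOn R (Set.Icc a b) :=
    fun s hs => (hRd s hs).continuousAt.continuousWithinAt
  have hNc : ContinuousOn N (Set.Icc a b) :=
    fun s hs => (hNd s hs).continuousAt.continuousWithinAt
  have hDc : ContinuousOn D (Set.Icc a b) :=
    fun s hs => (hDd s hs).continuousAt.continuousWithinAt
  have hφ'c : ContinuousOn φ' (Set.Icc a b) :=
    (ContinuousOn.div (by fun_prop) hRc fun s hs => (hR s hs).ne').add continuousOn_const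
  have hN'c : ContinuousOn N' (Set.Icc a b) :=
    ((ContinuousOn.add (by fun_prop) hRc).add
      (ContinuousOn.div (by fun_prop) hRc fun s hs => (hR s hs).ne')).neg
  have hD'c : ContinuousOn D' (Set.Icc a b) := by fun_prop
  have hg'c : ContinuousOn g' (Set.Icc a b) :=
    (((hN'c.mul hDc).sub (hNc.mul hD'c)).div (hDc.pow 2)
      fun s hs => pow_ne_zero 2 (hD s hs).ne').neg
  have hNpos : ∀ s ∈ Set.Icc a b, 0 ≤ N s := by
    intro s hs
    have h1 := hR s hs
    have h2 : 0 ≤ t - s := by linarith [hs.2]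
    change 0 ≤ R s * (2 * R s + (t - s))
    positivity
  have hg'0 : ∀ s ∈ Set.Icc a b, 0 ≤ g' s := by
    intro s hs
    have h1 := hR s hs
    have h2 : 0 ≤ t - s := by linarith [hs.2]
    have h3 := hs0 s hs
    have hN' : N' s ≤ 0 := by
      change -(4 * (t - s) + R s + (t - s) ^ 2 / R s) ≤ 0
      have : 0 ≤ 4 * (t - s) + R s + (t - s) ^ 2 / R s := by positivity
      linarith
    have hD' : 0 ≤ D' s := by
      change 0 ≤ 3 * (4 * t * s - 3 * s ^ 2)
      nlinarith
    have h4 := mul_nonpos_of_nonpos_of_nonneg hN' (hD s hs).le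
    have h5 := mul_nonneg (hNpos s hs) hD'
    exact neg_nonneg.mpr (div_nonpos_of_nonpos_of_nonneg (by linarith) (sq_nonneg _))
  have hgb : ∀ s ∈ Set.Icc a b, |g s| ≤ 1000000 / 3 := by
    intro s hs
    have h1 := hR s hs
    have h3 := hs0 s hs
    have h2 : 0 ≤ t - s := by linarith [hs.2]
    have hRt : R s ≤ t / 2 := by
      apply le_of_sq_le_sq _ (by positivity)
      rw [hR2 s hs]
      nlinarith
    have hNt : N s ≤ t ^ 2 := by
      change R s * (2 * R s + (t - s)) ≤ t ^ 2
      calc _ ≤ t / 2 * (2 * (t / 2) + t) := by gcongr; linarith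
        _ = t ^ 2 := by ring
    have hst : t / 1000000 ≤ s ^ 2 := by
      rw [← hat]
      exact pow_le_pow_left₀ ha.le hs.1 2
    have hDt : 3 * (t / 1000000 * t) ≤ D s := by
      change _ ≤ 3 * (s ^ 2 * (2 * t - s))
      gcongr
      linarith
    rw [abs_neg, abs_of_nonneg (div_nonneg (hNpos s hs) (hD s hs).le), div_le_iff₀ (hD s hs)]
    linarith
  have key := norm_integral_mul_deriv_mul_exp_le hab hφd hgd hφ'c hg'c hg'0
  have heq : ∫ s in a..b,
        Complex.exp (Complex.I * (Real.sqrt ((t - s) ^ 2 - 3 / 4 * t ^ 2) + 2 * s)) / s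
      = ∫ s in a..b, ((g s * φ' s : ℝ) : ℂ) * Complex.exp (Complex.I * φ s) := by
    refine integral_congr fun s hs => ?_
    rw [Set.uIcc_of_le hab] at hs
    have hgφ : g s * φ' s = s⁻¹ := by
      have h1 := (hR s hs).ne'
      have h2 := (hD s hs).ne'
      have h3 := (hs0 s hs).ne'
      have h4 : φ' s = (2 * R s - (t - s)) / R s := by
        simp only [φ']
        field_simp
        ring
      have h5 : -(N s * (2 * R s - (t - s))) * s = D s * R s := by
        simp only [N, D]
        linear_combination (-4 * R s * s) * hR2 s hs
      rw [h4]
      apply eq_inv_of_mul_eq_one_left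
      simp only [g]
      field_simp
      linarith
    simp only [hgφ, φ, R, q]
    push_cast
    rw [div_eq_inv_mul]
  rw [heq]
  have h1 := hgb a ⟨le_rfl, hab⟩
  have h2 := hgb b ⟨hab, le_rfl⟩
  linarith
end

section
/- There exists an absolute constant c > 0 with the following property: for every u ∈ (−1, 1), setting ξ₀ := −u/√(1−u²), and for every ξ ∈ ℝ with |ξ − ξ₀| ≥ √(1+ξ₀²)/100, one has |ξ/√(1+ξ²) + u| ≥ c/(1+ξ²). -/
/-- If `A = √(1+a²)` and `B = √(1+b²)`, then `|a - b| ≥ B/100` forces a lower bound on the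
hyperbolic sine `a * B - b * A` of the difference of the rapidities of `a` and `b`. -/
theorem div_le_abs_mul_sub_mul_mul {a b A B : ℝ} (hA : 0 < A) (hB : 0 < B)
    (hA2 : A ^ 2 = 1 + a ^ 2) (hB2 : B ^ 2 = 1 + b ^ 2) (hab : B / 100 ≤ |a - b|) :
    B / 202 ≤ |a * B - b * A| * A := by
  obtain ⟨s, hs⟩ : ∃ s, s = a * B - b * A := ⟨_, rfl⟩
  obtain ⟨C, hC⟩ : ∃ C, C = A * B - a * b := ⟨_, rfl⟩
  rw [← hs]
  have haA : |a| ≤ A := abs_le_of_sq_le_sq (by linarith) hA.le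
  have hbB : |b| ≤ B := abs_le_of_sq_le_sq (by linarith) hB.le
  have hC0 : 0 ≤ C := by
    have h : |a| * |b| ≤ A * B := mul_le_mul haA hbB (abs_nonneg b) hA.le
    rw [← abs_mul] at h
    linarith [le_abs_self (a * b)]
  have hC2 : C ^ 2 = 1 + s ^ 2 := by
    rw [hs, hC]
    linear_combination (B ^ 2 - b ^ 2) * hA2 + hB2
  have ha : a = b * C + B * s := by
    rw [hs, hC]
    linear_combination -a * hB2
  have hA' : A = B * C + b * s := by
    rw [hs, hC]
    linear_combination -A * hB2
  have hs2 := sq_abs s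
  have hs0 := abs_nonneg s
  have hC1 : 1 ≤ C := by nlinarith
  have hCs : C ≤ 1 + |s| := by nlinarith
  have hupper : |a - b| ≤ B * (2 * |s|) := by
    calc |a - b| = |b * (C - 1) + B * s| := by rw [ha]; ring_nf
      _ ≤ |b * (C - 1)| + |B * s| := abs_add_le _ _
      _ = |b| * (C - 1) + B * |s| := by
        rw [abs_mul, abs_mul, abs_of_nonneg (sub_nonneg.2 hC1), abs_of_pos hB]
      _ ≤ B * (C - 1) + B * |s| := by gcongr
      _ ≤ B * (2 * |s|) := by nlinarith
  have hs200 : 1 / 200 ≤ |s| := by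
    by_contra! h
    nlinarith
  have hlower : B * (C - |s|) ≤ A := by
    have h : |b * s| ≤ B * |s| := by
      rw [abs_mul]
      gcongr
    linarith [neg_abs_le (b * s)]
  have hprod : (C - |s|) * (C + |s|) = 1 := by linear_combination hC2 - hs2
  have hgap : 0 < C - |s| := by
    by_contra! h
    nlinarith
  have hkey : 1 / 202 ≤ |s| * (C - |s|) := by
    nlinarith
  calc B / 202 = B * (1 / 202) := by ring
    _ ≤ B * (|s| * (C - |s|)) := by gcongr
    _ = |s| * (B * (C - |s|)) := by ring
    _ ≤ |s| * A := by gcongr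

/-- Nonstationarity of the Klein–Gordon phase away from the stationary point: there
exists `c > 0` such that for `u ∈ (−1, 1)` and `ξ₀ = −u/√(1−u²)`, every `ξ` with
`|ξ − ξ₀| ≥ √(1+ξ₀²)/100` satisfies `|ξ/√(1+ξ²) + u| ≥ c/(1+ξ²)`. -/
theorem kleinGordon_phase_nonstationary :
    ∃ c : ℝ, 0 < c ∧ ∀ u : ℝ, u ∈ Set.Ioo (-1 : ℝ) 1 →
      ∀ ξ : ℝ,
        Real.sqrt (1 + (-u / Real.sqrt (1 - u ^ 2)) ^ 2) / 100
            ≤ |ξ - (-u / Real.sqrt (1 - u ^ 2))| →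
        c / (1 + ξ ^ 2) ≤ |ξ / Real.sqrt (1 + ξ ^ 2) + u| := by
  refine ⟨1 / 202, by norm_num, ?_⟩
  rintro u ⟨hu1, hu2⟩ ξ h
  have hu : 0 < 1 - u ^ 2 := by nlinarith
  have hr : 0 < √(1 - u ^ 2) := Real.sqrt_pos.2 hu
  have hr2 : √(1 - u ^ 2) ^ 2 = 1 - u ^ 2 := Real.sq_sqrt hu.le
  have hB2 := Real.sq_sqrt (by positivity : 0 ≤ 1 + (-u / √(1 - u ^ 2)) ^ 2)
  have hB : 0 < √(1 + (-u / √(1 - u ^ 2)) ^ 2) := by positivity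
  have hA2 := Real.sq_sqrt (by positivity : 0 ≤ 1 + ξ ^ 2)
  have hA : 0 < √(1 + ξ ^ 2) := by positivity
  have key := div_le_abs_mul_sub_mul_mul hA hB hA2 hB2 h
  have hBr : √(1 + (-u / √(1 - u ^ 2)) ^ 2) = 1 / √(1 - u ^ 2) := by
    rw [Real.sqrt_eq_iff_mul_self_eq (by positivity) (by positivity)]
    field_simp
    linarith
  rw [hBr] at key
  generalize √(1 + ξ ^ 2) = A at *
  generalize √(1 - u ^ 2) = r at *
  have hdiff : ξ * (1 / r) - -u / r * A = (ξ / A + u) * (A / r) := by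
    field_simp
    ring
  rw [hdiff, abs_mul, abs_of_pos (div_pos hA hr)] at key
  rw [← hA2, div_le_iff₀ (by positivity)]
  calc 1 / 202 = 1 / r / 202 * r := by field_simp
    _ ≤ |ξ / A + u| * (A / r) * A * r := by gcongr
    _ = |ξ / A + u| * A ^ 2 := by field_simp
end

section
/- For every u ∈ (−1, 1) and every ξ ∈ ℝ, setting ξ₀ := −u/√(1−u²), the following identity holds: √(1+ξ²) + uξ − √(1−u²) = (ξ − ξ₀)² / ( √(1+ξ₀²) · (1 + ξξ₀ + √(1+ξ²)·√(1+ξ₀²)) ). -/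
/-- Explicit perfect-square identity for the Klein–Gordon phase increment: for
`u ∈ (−1, 1)` and `ξ₀ = −u/√(1−u²)`,
`√(1+ξ²) + uξ − √(1−u²) = (ξ − ξ₀)² / (√(1+ξ₀²) (1 + ξξ₀ + √(1+ξ²) √(1+ξ₀²)))`. -/
theorem kleinGordon_phase_square_identity
    (u : ℝ) (hu : u ∈ Set.Ioo (-1 : ℝ) 1) (ξ : ℝ) :
    Real.sqrt (1 + ξ ^ 2) + u * ξ - Real.sqrt (1 - u ^ 2) =
      (ξ - (-u / Real.sqrt (1 - u ^ 2))) ^ 2 /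
        (Real.sqrt (1 + (-u / Real.sqrt (1 - u ^ 2)) ^ 2) *
          (1 + ξ * (-u / Real.sqrt (1 - u ^ 2)) +
            Real.sqrt (1 + ξ ^ 2) * Real.sqrt (1 + (-u / Real.sqrt (1 - u ^ 2)) ^ 2))) := by
  obtain ⟨hu₁, hu₂⟩ := hu
  have hpos : 0 < 1 - u ^ 2 := by nlinarith
  have hs : 0 < Real.sqrt (1 - u ^ 2) := Real.sqrt_pos.mpr hpos
  have hs2 : Real.sqrt (1 - u ^ 2) ^ 2 = 1 - u ^ 2 := Real.sq_sqrt hpos.le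
  have hA2 : Real.sqrt (1 + ξ ^ 2) ^ 2 = 1 + ξ ^ 2 := Real.sq_sqrt (by positivity)
  have hA : u * ξ < Real.sqrt (1 + ξ ^ 2) :=
    Real.lt_sqrt_of_sq_lt (by nlinarith [mul_nonneg hpos.le (sq_nonneg ξ)])
  have hξ₀ : Real.sqrt (1 + (-u / Real.sqrt (1 - u ^ 2)) ^ 2) =
      1 / Real.sqrt (1 - u ^ 2) := by
    rw [Real.sqrt_eq_iff_mul_self_eq (by positivity) (by positivity)]
    field_simp
    linarith
  rw [hξ₀]
  set s := Real.sqrt (1 - u ^ 2)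
  set A := Real.sqrt (1 + ξ ^ 2)
  have hD : 0 < s - u * ξ + A := by linarith
  have hden : 1 / s * (1 + ξ * (-u / s) + A * (1 / s)) = (s - u * ξ + A) / s ^ 2 := by
    field_simp
    ring
  have hnum : (ξ - -u / s) ^ 2 = (s * ξ + u) ^ 2 / s ^ 2 := by
    field_simp
    ring
  rw [hden, hnum, div_div_div_cancel_right₀ (by positivity), eq_div_iff hD.ne']
  linear_combination hA2 - (1 + ξ ^ 2) * hs2
end
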